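/- arXiv:2509.24569 — 13 statements merged into one kernel-verified Lean document; each statement's English description precedes it below -/
import Mathlib

section
/- Let P and Q be probability measures on a common measurable space (Ω, Σ), let μ := (1/2)(P + Q), and let p := dP/dμ and q := dQ/dμ be Radon–Nikodym derivatives. Then for every measurable set A ∈ Σ, P(A) + Q(Ω \ A) ≥ (1/2) · ( ∫_Ω √(p(ω) q(ω)) dμ(ω) )². -/
open MeasureTheory
open scoped ENNReal

/-- **Cauchy–Schwarz** for the square roots of Radon–Nikodym derivatives. -/
theorem MeasureTheory.Measure.setIntegral_sqrt_rnDeriv_mul_rnDeriv_le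
    {Ω : Type*} [MeasurableSpace Ω] (P Q μ : Measure Ω) [IsFiniteMeasure P] [IsFiniteMeasure Q]
    (s : Set Ω) :
    IntegrableOn (fun ω ↦ √((P.rnDeriv μ ω).toReal * (Q.rnDeriv μ ω).toReal)) s μ ∧
      ∫ ω in s, √((P.rnDeriv μ ω).toReal * (Q.rnDeriv μ ω).toReal) ∂μ
        ≤ √(P.real s) * √(Q.real s) := by
  have memLp_sqrt (R : Measure Ω) [IsFiniteMeasure R] :
      MemLp (fun ω ↦ √(R.rnDeriv μ ω).toReal) 2 (μ.restrict s) := by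
    rw [memLp_two_iff_integrable_sq
      (R.measurable_rnDeriv μ).ennreal_toReal.sqrt.aestronglyMeasurable]
    simpa using (Measure.integrable_toReal_rnDeriv (μ := R) (ν := μ)).restrict (s := s)
  have hP := memLp_sqrt P
  have hQ := memLp_sqrt Q
  simp only [Real.sqrt_mul ENNReal.toReal_nonneg]
  refine ⟨hP.integrable_mul hQ, ?_⟩
  have holder := integral_mul_le_Lp_mul_Lq_of_nonneg Real.HolderConjugate.two_two
    (.of_forall fun ω ↦ Real.sqrt_nonneg (P.rnDeriv μ ω).toReal)
    (.of_forall fun ω ↦ Real.sqrt_nonneg (Q.rnDeriv μ ω).toReal)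
    (by simpa using hP) (by simpa using hQ)
  simp only [Real.rpow_two, Real.sq_sqrt ENNReal.toReal_nonneg, ← Real.sqrt_eq_rpow] at holder
  refine holder.trans ?_
  gcongr
  · exact Measure.setIntegral_toReal_rnDeriv_le (measure_ne_top P s)
  · exact Measure.setIntegral_toReal_rnDeriv_le (measure_ne_top Q s)

/-- Bretagnolle–Huber-type inequality with the squared Bhattacharyya coefficient:
for probability measures `P, Q`, with `μ = (1/2)(P+Q)`, `p = dP/dμ`, `q = dQ/dμ`,
and any measurable set `A`, we have
`P(A) + Q(Aᶜ) ≥ (1/2) (∫ √(p q) dμ)²`. -/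
theorem bretagnolle_huber_bhattacharyya
    {Ω : Type*} [MeasurableSpace Ω]
    (P Q : Measure Ω) [IsProbabilityMeasure P] [IsProbabilityMeasure Q]
    (μ : Measure Ω) (hμ : μ = (1 / 2 : ℝ≥0∞) • (P + Q))
    (p q : Ω → ℝ≥0∞) (hp : p = P.rnDeriv μ) (hq : q = Q.rnDeriv μ)
    (A : Set Ω) (hA : MeasurableSet A) :
    (1 / 2 : ℝ) * (∫ ω, Real.sqrt ((p ω).toReal * (q ω).toReal) ∂μ) ^ 2
      ≤ (P A).toReal + (Q Aᶜ).toReal := by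
  subst hp hq
  obtain ⟨integrable_A, hle⟩ := P.setIntegral_sqrt_rnDeriv_mul_rnDeriv_le Q μ A
  obtain ⟨integrable_compl, hle'⟩ := P.setIntegral_sqrt_rnDeriv_mul_rnDeriv_le Q μ Aᶜ
  have hsplit := setIntegral_union disjoint_compl_right hA.compl integrable_A integrable_compl
  rw [Set.union_compl_self, setIntegral_univ] at hsplit
  have hA_le : √(P.real A) * √(Q.real A) ≤ √(P.real A) :=
    mul_le_of_le_one_right (Real.sqrt_nonneg _) (Real.sqrt_le_one.2 measureReal_le_one)
  have hAc_le : √(P.real Aᶜ) * √(Q.real Aᶜ) ≤ √(Q.real Aᶜ) :=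
    mul_le_of_le_one_left (Real.sqrt_nonneg _) (Real.sqrt_le_one.2 measureReal_le_one)
  calc (1 / 2 : ℝ) * (∫ ω, √((P.rnDeriv μ ω).toReal * (Q.rnDeriv μ ω).toReal) ∂μ) ^ 2
      ≤ 1 / 2 * (√(P.real A) + √(Q.real Aᶜ)) ^ 2 := by
        gcongr
        linarith
    _ ≤ √(P.real A) ^ 2 + √(Q.real Aᶜ) ^ 2 := by
        linarith [add_sq_le (a := √(P.real A)) (b := √(Q.real Aᶜ))]
    _ = (P A).toReal + (Q Aᶜ).toReal := by
        rw [Real.sq_sqrt measureReal_nonneg, Real.sq_sqrt measureReal_nonneg, measureReal_def,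
          measureReal_def]
end

section
/- Let (Ω, Σ) be a measurable space, n a positive integer, and O : Σ → M_n(ℂ) a POVM with O(Ω) ≤ I in the Loewner order. Define the finite nonnegative measure μ_O on (Ω, Σ) by μ_O(A) := Tr(O(A)). Then there exists a function K : Ω → M_n(ℂ), with each entry μ_O-integrable, such that for every matrix σ ∈ M_n(ℂ) and every A ∈ Σ one has Tr(O(A) σ) = ∫_A Tr(K(ω) σ) dμ_O(ω). In particular, the density f_σ(ω) := Tr(K(ω) σ) of the complex measure A ↦ Tr(O(A) σ) with respect to μ_O is linear in σ. -/
open MeasureTheory Matrix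
open scoped ComplexOrder

/-- **Radon-Nikodym** for a countably additive real set function that vanishes on null sets. -/
theorem exists_integrable_setIntegral_eq_real {Ω : Type*} [MeasurableSpace Ω]
    (μ : Measure Ω) [SigmaFinite μ] (g : Set Ω → ℝ)
    (hempty : g ∅ = 0)
    (hadd : ∀ f : ℕ → Set Ω, (∀ i, MeasurableSet (f i)) →
      Pairwise (Function.onFun Disjoint f) → HasSum (fun i => g (f i)) (g (⋃ i, f i)))
    (hnull : ∀ A, MeasurableSet A → μ A = 0 → g A = 0) :
    ∃ f : Ω → ℝ, Integrable f μ ∧ ∀ A, MeasurableSet A → g A = ∫ ω in A, f ω ∂μ := by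
  classical
  let s : SignedMeasure Ω :=
    { measureOf' := fun A => if MeasurableSet A then g A else 0
      empty' := by simp [hempty]
      not_measurable' := fun A hA => by simp [hA]
      m_iUnion' := fun f hf hd => by
        simpa [hf, MeasurableSet.iUnion hf] using hadd f hf hd }
  have hs : ∀ A, MeasurableSet A → s A = g A := fun A hA => if_pos hA
  have hac : s ≪ᵥ μ.toENNRealVectorMeasure := by
    refine VectorMeasure.AbsolutelyContinuous.mk fun A hA h0 => ?_
    rw [Measure.toENNRealVectorMeasure_apply_measurable hA] at h0
    rw [hs A hA, hnull A hA h0]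
  refine ⟨s.rnDeriv μ, SignedMeasure.integrable_rnDeriv s μ, fun A hA => ?_⟩
  rw [← withDensityᵥ_apply (SignedMeasure.integrable_rnDeriv s μ) hA,
    SignedMeasure.withDensityᵥ_rnDeriv_eq s μ hac, hs A hA]

/-- **Radon-Nikodym** for a countably additive complex set function that vanishes on null sets. -/
theorem exists_integrable_setIntegral_eq_complex {Ω : Type*} [MeasurableSpace Ω]
    (μ : Measure Ω) [SigmaFinite μ] (g : Set Ω → ℂ)
    (hempty : g ∅ = 0)
    (hadd : ∀ f : ℕ → Set Ω, (∀ i, MeasurableSet (f i)) →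
      Pairwise (Function.onFun Disjoint f) → HasSum (fun i => g (f i)) (g (⋃ i, f i)))
    (hnull : ∀ A, MeasurableSet A → μ A = 0 → g A = 0) :
    ∃ f : Ω → ℂ, Integrable f μ ∧ ∀ A, MeasurableSet A → g A = ∫ ω in A, f ω ∂μ := by
  obtain ⟨u, hu, hgu⟩ := exists_integrable_setIntegral_eq_real μ (fun A => (g A).re)
    (by simp [hempty]) (fun f hf hd => Complex.hasSum_re (hadd f hf hd))
    (fun A hA h0 => by simp [hnull A hA h0])
  obtain ⟨v, hv, hgv⟩ := exists_integrable_setIntegral_eq_real μ (fun A => (g A).im)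
    (by simp [hempty]) (fun f hf hd => Complex.hasSum_im (hadd f hf hd))
    (fun A hA h0 => by simp [hnull A hA h0])
  have hu' : Integrable (fun ω => (u ω : ℂ)) μ := hu.ofReal
  have hv' : Integrable (fun ω => (v ω : ℂ) * Complex.I) μ := hv.ofReal.mul_const _
  refine ⟨fun ω => u ω + v ω * Complex.I, hu'.add hv', fun A hA => ?_⟩
  rw [integral_add hu'.integrableOn hv'.integrableOn, integral_mul_const,
    integral_complex_ofReal, integral_complex_ofReal, ← hgu A hA, ← hgv A hA, Complex.re_add_im]

/-- A POVM `O` on `(Ω, Σ)` with values in `M_n(ℂ)` and `O(Ω) ≤ I` admits an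
operator-valued density `K` with respect to the trace measure `μ_O(A) = Tr(O(A))`:
for every `σ` and every measurable `A`, `Tr(O(A) σ) = ∫_A Tr(K(ω) σ) dμ_O(ω)`.
In particular the density `ω ↦ Tr(K(ω) σ)` is linear in `σ`. -/
theorem povm_has_matrix_density
    {Ω : Type*} [MeasurableSpace Ω] {n : ℕ} (hn : 0 < n)
    (O : Set Ω → Matrix (Fin n) (Fin n) ℂ)
    (hpos : ∀ A : Set Ω, MeasurableSet A → (O A).PosSemidef)
    (hadd : ∀ f : ℕ → Set Ω, (∀ i, MeasurableSet (f i)) →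
      Pairwise (Function.onFun Disjoint f) →
      HasSum (fun i => O (f i)) (O (⋃ i, f i)))
    (hle : ((1 : Matrix (Fin n) (Fin n) ℂ) - O Set.univ).PosSemidef)
    (μO : Measure Ω) [IsFiniteMeasure μO]
    (hμO : ∀ A : Set Ω, MeasurableSet A → μO A = ENNReal.ofReal ((O A).trace.re)) :
    ∃ K : Ω → Matrix (Fin n) (Fin n) ℂ,
      (∀ i j, Integrable (fun ω => K ω i j) μO) ∧
      ∀ (σ : Matrix (Fin n) (Fin n) ℂ) (A : Set Ω), MeasurableSet A →
        (O A * σ).trace = ∫ ω in A, (K ω * σ).trace ∂μO := by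
  have hempty : O ∅ = 0 := by
    have h := hadd (fun _ => ∅) (fun _ => .empty) (fun _ _ _ => disjoint_bot_left)
    exact (summable_const_iff _).mp h.summable
  have hnull : ∀ A, MeasurableSet A → μO A = 0 → O A = 0 := fun A hA h0 => by
    have htr := (hpos A hA).trace_nonneg
    rw [hμO A hA, ENNReal.ofReal_eq_zero] at h0
    rw [← (hpos A hA).trace_eq_zero_iff]
    rw [Complex.le_def] at htr
    exact Complex.ext (le_antisymm h0 htr.1) htr.2.symm
  have hdens (i j : Fin n) := exists_integrable_setIntegral_eq_complex μO (fun A => O A i j)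
    (by simp [hempty])
    (fun f hf hd => Pi.hasSum.mp (Pi.hasSum.mp (hadd f hf hd) i) j)
    (fun A hA h0 => by simp [hnull A hA h0])
  choose K hK hOK using hdens
  refine ⟨fun ω => Matrix.of fun i j => K i j ω, hK, fun σ A hA => ?_⟩
  have hint (i j : Fin n) : Integrable (fun ω => K i j ω * σ j i) (μO.restrict A) :=
    (hK i j).integrableOn.mul_const _
  simp only [Matrix.trace, Matrix.diag_apply, Matrix.mul_apply, Matrix.of_apply]
  rw [integral_finsetSum _ fun i _ => integrable_finsetSum _ fun j _ => hint i j]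
  refine Finset.sum_congr rfl fun i _ => ?_
  rw [integral_finsetSum _ fun j _ => hint i j]
  refine Finset.sum_congr rfl fun j _ => ?_
  rw [integral_mul_const, ← hOK i j A hA]
end

section
/- Let (Ω, Σ) be a measurable space, n a positive integer, and O : Σ → M_n(ℂ) a POVM with O(Ω) ≤ I in the Loewner order, and let μ_O be the finite measure μ_O(A) := Tr(O(A)). Then there exists a function K : Ω → M_n(ℂ), with each entry μ_O-integrable, such that (i) K(ω) is positive semidefinite for μ_O-almost every ω ∈ Ω, and (ii) for every σ ∈ M_n(ℂ) and every A ∈ Σ, Tr(O(A) σ) = ∫_A Tr(K(ω) σ) dμ_O(ω); that is, K is a positive-semidefinite operator-valued density of the POVM O with respect to μ_O. -/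
open MeasureTheory Matrix
open scoped ComplexOrder

/-- Radon–Nikodym for complex measures: an absolutely continuous complex measure is recovered by
integrating its derivative. -/
lemma MeasureTheory.ComplexMeasure.setIntegral_rnDeriv_of_null {Ω : Type*} [MeasurableSpace Ω]
    (c : ComplexMeasure Ω) (μ : Measure Ω) [SigmaFinite μ]
    (h : ∀ s, MeasurableSet s → μ s = 0 → c s = 0) {A : Set Ω} (hA : MeasurableSet A) :
    ∫ ω in A, c.rnDeriv μ ω ∂μ = c A := by
  have hre : c.re ≪ᵥ μ.toENNRealVectorMeasure := by
    refine VectorMeasure.AbsolutelyContinuous.mk fun s hs h0 => ?_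
    rw [Measure.toENNRealVectorMeasure_apply_measurable hs] at h0
    exact congrArg Complex.re (h s hs h0)
  have him : c.im ≪ᵥ μ.toENNRealVectorMeasure := by
    refine VectorMeasure.AbsolutelyContinuous.mk fun s hs h0 => ?_
    rw [Measure.toENNRealVectorMeasure_apply_measurable hs] at h0
    exact congrArg Complex.im (h s hs h0)
  have key (s : SignedMeasure Ω) (hs : s ≪ᵥ μ.toENNRealVectorMeasure) :
      ∫ ω in A, s.rnDeriv μ ω ∂μ = s A := by
    rw [← withDensityᵥ_apply (SignedMeasure.integrable_rnDeriv s μ) hA,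
      SignedMeasure.withDensityᵥ_rnDeriv_eq s μ hs]
  have hi : IntegrableOn (c.rnDeriv μ) A μ := (c.integrable_rnDeriv μ).integrableOn
  apply Complex.ext
  · rw [← RCLike.re_eq_complex_re, ← integral_re hi]
    exact key c.re hre
  · rw [← RCLike.im_eq_complex_im, ← integral_im hi]
    exact key c.im him

/-- A complex function whose integral over every measurable set is nonnegative is itself
nonnegative almost everywhere. -/
lemma MeasureTheory.Integrable.ae_nonneg_of_forall_setIntegral_nonneg_complex {Ω : Type*}
    [MeasurableSpace Ω] {μ : Measure Ω} {f : Ω → ℂ} (hf : Integrable f μ)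
    (h : ∀ A, MeasurableSet A → 0 ≤ ∫ ω in A, f ω ∂μ) : ∀ᵐ ω ∂μ, 0 ≤ f ω := by
  have hre : 0 ≤ᵐ[μ] fun ω => RCLike.re (f ω) := by
    refine ae_nonneg_of_forall_setIntegral_nonneg hf.re fun A hA _ => ?_
    rw [integral_re hf.integrableOn]
    exact (Complex.nonneg_iff.mp (h A hA)).1
  have him : (fun ω => RCLike.im (f ω)) =ᵐ[μ] 0 := by
    refine hf.im.ae_eq_zero_of_forall_setIntegral_eq_zero fun A hA _ => ?_
    rw [integral_im hf.integrableOn]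
    exact (Complex.nonneg_iff.mp (h A hA)).2.symm
  filter_upwards [hre, him] with ω h1 h2
  exact Complex.nonneg_iff.mpr ⟨h1, h2.symm⟩

/-- A matrix-valued function all of whose integrals `∫_A K` are positive semidefinite is itself
positive semidefinite almost everywhere. -/
lemma ae_posSemidef_of_setIntegral_posSemidef {Ω n : Type*} [MeasurableSpace Ω] [Fintype n]
    {μ : Measure Ω} {K : Ω → Matrix n n ℂ} {P : Set Ω → Matrix n n ℂ}
    (hK : ∀ i j, Integrable (fun ω => K ω i j) μ)
    (hP : ∀ A, MeasurableSet A → (P A).PosSemidef)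
    (hint : ∀ A, MeasurableSet A → ∀ i j, ∫ ω in A, K ω i j ∂μ = P A i j) :
    ∀ᵐ ω ∂μ, (K ω).PosSemidef := by
  have herm : ∀ᵐ ω ∂μ, ∀ i j, star (K ω j i) - K ω i j = 0 := by
    simp_rw [ae_all_iff]
    intro i j
    have hs : Integrable (fun ω => star (K ω j i)) μ :=
      (Complex.conjCLE : ℂ →L[ℝ] ℂ).integrable_comp (hK j i)
    refine (hs.sub (hK i j)).ae_eq_zero_of_forall_setIntegral_eq_zero fun A hA _ => ?_
    have hconj : ∫ ω in A, star (K ω j i) ∂μ = star (∫ ω in A, K ω j i ∂μ) := integral_conj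
    simp only [Pi.sub_apply]
    rw [integral_sub hs.integrableOn (hK i j).integrableOn, hconj, hint A hA, hint A hA,
      (hP A hA).isHermitian.apply, sub_self]
  have hquad (x : n → ℂ) : ∀ᵐ ω ∂μ, 0 ≤ star x ⬝ᵥ K ω *ᵥ x := by
    simp only [dotProduct, mulVec]
    have hterm (i j : n) : Integrable (fun ω => K ω i j * x j) μ := (hK i j).mul_const _
    have hrow (i : n) : Integrable (fun ω => star x i * ∑ j, K ω i j * x j) μ :=
      (integrable_finsetSum _ fun j _ => hterm i j).const_mul _
    refine (integrable_finsetSum _ fun i _ => hrow i)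
      |>.ae_nonneg_of_forall_setIntegral_nonneg_complex fun A hA => ?_
    have heq : ∫ ω in A, ∑ i, star x i * ∑ j, K ω i j * x j ∂μ = star x ⬝ᵥ P A *ᵥ x := by
      simp only [dotProduct, mulVec]
      rw [integral_finsetSum _ fun i _ => (hrow i).integrableOn]
      refine Finset.sum_congr rfl fun i _ => ?_
      rw [integral_const_mul, integral_finsetSum _ fun j _ => (hterm i j).integrableOn]
      simp_rw [integral_mul_const, hint A hA]
    rw [heq]
    exact (hP A hA).dotProduct_mulVec_nonneg x
  have hdense : ∀ᵐ ω ∂μ, ∀ k, 0 ≤ star (TopologicalSpace.denseSeq (n → ℂ) k) ⬝ᵥ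
      K ω *ᵥ TopologicalSpace.denseSeq (n → ℂ) k :=
    ae_all_iff.mpr fun k => hquad _
  filter_upwards [herm, hdense] with ω h1 h2
  refine PosSemidef.of_dotProduct_mulVec_nonneg
    (Matrix.ext fun i j => sub_eq_zero.mp (h1 i j)) fun x => ?_
  refine isClosed_property (TopologicalSpace.denseRange_denseSeq (n → ℂ))
    (p := fun x => 0 ≤ star x ⬝ᵥ K ω *ᵥ x) ?_ h2 x
  exact isClosed_le continuous_const (by fun_prop)

/-- A countably additive function on the measurable sets, as a complex measure. -/
noncomputable def complexMeasureOfHasSum {Ω : Type*} [MeasurableSpace Ω] (F : Set Ω → ℂ)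
    (h0 : F ∅ = 0)
    (hF : ∀ f : ℕ → Set Ω, (∀ i, MeasurableSet (f i)) →
      Pairwise (Function.onFun Disjoint f) → HasSum (fun i => F (f i)) (F (⋃ i, f i))) :
    ComplexMeasure Ω where
  measureOf' := open Classical in fun A => if MeasurableSet A then F A else 0
  empty' := by simp [h0]
  not_measurable' _ hA := if_neg hA
  m_iUnion' f hf hd := by
    simpa only [hf, MeasurableSet.iUnion hf, if_true] using hF f hf hd

lemma complexMeasureOfHasSum_apply {Ω : Type*} [MeasurableSpace Ω] {F : Set Ω → ℂ}
    (h0 : F ∅ = 0)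
    (hF : ∀ f : ℕ → Set Ω, (∀ i, MeasurableSet (f i)) →
      Pairwise (Function.onFun Disjoint f) → HasSum (fun i => F (f i)) (F (⋃ i, f i)))
    {A : Set Ω} (hA : MeasurableSet A) : complexMeasureOfHasSum F h0 hF A = F A :=
  if_pos hA

/-- A POVM `O` on `(Ω, Σ)` with values in `M_n(ℂ)` and `O(Ω) ≤ I` admits an
operator-valued density `K` with respect to the trace measure `μ_O(A) = Tr(O(A))`
which is positive semidefinite `μ_O`-almost everywhere:
`Tr(O(A) σ) = ∫_A Tr(K(ω) σ) dμ_O(ω)` for every `σ` and measurable `A`. -/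
theorem povm_has_posSemidef_matrix_density
    {Ω : Type*} [MeasurableSpace Ω] {n : ℕ} (hn : 0 < n)
    (O : Set Ω → Matrix (Fin n) (Fin n) ℂ)
    (hpos : ∀ A : Set Ω, MeasurableSet A → (O A).PosSemidef)
    (hadd : ∀ f : ℕ → Set Ω, (∀ i, MeasurableSet (f i)) →
      Pairwise (Function.onFun Disjoint f) →
      HasSum (fun i => O (f i)) (O (⋃ i, f i)))
    (hle : ((1 : Matrix (Fin n) (Fin n) ℂ) - O Set.univ).PosSemidef)
    (μO : Measure Ω) [IsFiniteMeasure μO]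
    (hμO : ∀ A : Set Ω, MeasurableSet A → μO A = ENNReal.ofReal ((O A).trace.re)) :
    ∃ K : Ω → Matrix (Fin n) (Fin n) ℂ,
      (∀ i j, Integrable (fun ω => K ω i j) μO) ∧
      (∀ᵐ ω ∂μO, (K ω).PosSemidef) ∧
      ∀ (σ : Matrix (Fin n) (Fin n) ℂ) (A : Set Ω), MeasurableSet A →
        (O A * σ).trace = ∫ ω in A, (K ω * σ).trace ∂μO := by
  have hnull (A : Set Ω) (hA : MeasurableSet A) (h0 : μO A = 0) : O A = 0 := by
    rw [hμO A hA, ENNReal.ofReal_eq_zero] at h0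
    have htr := Complex.nonneg_iff.mp (hpos A hA).trace_nonneg
    exact (hpos A hA).trace_eq_zero_iff.mp
      (Complex.ext (le_antisymm h0 htr.1) htr.2.symm)
  have hempty : O ∅ = 0 := hnull ∅ MeasurableSet.empty measure_empty
  have hentry (i j : Fin n) (f : ℕ → Set Ω) (hf : ∀ k, MeasurableSet (f k))
      (hd : Pairwise (Function.onFun Disjoint f)) :
      HasSum (fun k => O (f k) i j) (O (⋃ k, f k) i j) :=
    Pi.hasSum.mp (Pi.hasSum.mp (hadd f hf hd) i) j
  let c (i j : Fin n) : ComplexMeasure Ω :=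
    complexMeasureOfHasSum (fun A => O A i j) (by simp [hempty]) (hentry i j)
  have hc (i j : Fin n) {A : Set Ω} (hA : MeasurableSet A) : c i j A = O A i j :=
    complexMeasureOfHasSum_apply _ _ hA
  let K : Ω → Matrix (Fin n) (Fin n) ℂ := fun ω => Matrix.of fun i j => (c i j).rnDeriv μO ω
  have hK (i j : Fin n) : Integrable (fun ω => K ω i j) μO := (c i j).integrable_rnDeriv μO
  have hint (A : Set Ω) (hA : MeasurableSet A) (i j : Fin n) :
      ∫ ω in A, K ω i j ∂μO = O A i j := by
    rw [← hc i j hA]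
    exact (c i j).setIntegral_rnDeriv_of_null μO
      (fun s hs h0 => by simp [hc i j hs, hnull s hs h0]) hA
  refine ⟨K, hK, ae_posSemidef_of_setIntegral_posSemidef hK hpos hint, fun σ A hA => ?_⟩
  have hterm (i j : Fin n) : Integrable (fun ω => K ω i j * σ j i) μO := (hK i j).mul_const _
  simp only [trace, diag_apply, mul_apply]
  rw [integral_finsetSum _ fun i _ =>
    (integrable_finsetSum _ fun j _ => hterm i j).integrableOn]
  refine Finset.sum_congr rfl fun i _ => ?_
  rw [integral_finsetSum _ fun j _ => (hterm i j).integrableOn]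
  simp_rw [integral_mul_const, hint A hA]
end

section
/- Let (c_t)_{t≥0} ⊂ S¹ be a sequence of unit vectors in ℝ², let C > 0, and let ω be a function from real symmetric positive semidefinite 2×2 matrices to nonnegative reals satisfying ω(X) ≤ C √(λ_max(X)) for all such X. Let λ₀ ≥ 4√2 C + 2 and define a sequence of matrices by V₀ := λ₀ I and V_{t+1} := V_t + ω(V_t)( a⁺_{t+1}(a⁺_{t+1})ᵀ + a⁻_{t+1}(a⁻_{t+1})ᵀ ), where, for any choice of unit eigenvector v_t of V_t with eigenvalue λ_min(V_t), the unit vectors a±_{t+1} are the normalizations of c_t ± (1/√(λ_min(V_t))) v_t. Then for all t ≥ 0, λ_min(V_t) ≥ √(2 λ_max(V_t)). -/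
open Matrix
open scoped Classical

/-- The largest eigenvalue of a real symmetric matrix (junk value `0` otherwise). -/
noncomputable def matLamMax {n : ℕ} (A : Matrix (Fin n) (Fin n) ℝ) : ℝ :=
  if h : A.IsHermitian then ⨆ i, h.eigenvalues i else 0

/-- The smallest eigenvalue of a real symmetric matrix (junk value `0` otherwise). -/
noncomputable def matLamMin {n : ℕ} (A : Matrix (Fin n) (Fin n) ℝ) : ℝ :=
  if h : A.IsHermitian then ⨅ i, h.eigenvalues i else 0

/-- The normalization `u / ‖u‖₂` of a vector `u ∈ ℝ^d`. -/
noncomputable def unitize {d : ℕ} (u : Fin d → ℝ) : Fin d → ℝ :=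
  (Real.sqrt (∑ i, u i ^ 2))⁻¹ • u

theorem matLamMin_add_matLamMax {A : Matrix (Fin 2) (Fin 2) ℝ} (h : A.IsHermitian) :
    matLamMin A + matLamMax A = A 0 0 + A 1 1 := by
  have htr := h.trace_eq_sum_eigenvalues
  simp only [trace_fin_two, Fin.sum_univ_two, RCLike.ofReal_real_eq_id, id] at htr
  have hsup : ⨆ i, h.eigenvalues i = max (h.eigenvalues 0) (h.eigenvalues 1) :=
    le_antisymm (ciSup_le (by simp [Fin.forall_fin_two]))
      (max_le (le_ciSup (Set.finite_range _).bddAbove 0)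
        (le_ciSup (Set.finite_range _).bddAbove 1))
  have hinf : ⨅ i, h.eigenvalues i = min (h.eigenvalues 0) (h.eigenvalues 1) :=
    le_antisymm (le_min (ciInf_le (Set.finite_range _).bddBelow 0)
        (ciInf_le (Set.finite_range _).bddBelow 1))
      (le_ciInf (by simp [Fin.forall_fin_two]))
  rw [matLamMin, matLamMax, dif_pos h, dif_pos h, hsup, hinf, min_add_max, htr]

theorem matLamMin_le_matLamMax {A : Matrix (Fin 2) (Fin 2) ℝ} (h : A.IsHermitian) :
    matLamMin A ≤ matLamMax A := by
  rw [matLamMin, matLamMax, dif_pos h, dif_pos h]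
  exact (ciInf_le (Set.finite_range _).bddBelow 0).trans
    (le_ciSup (Set.finite_range _).bddAbove 0)

/-- A symmetric matrix is determined by its trace and one unit eigenvector. -/
theorem entries_of_unit_eigenvector {A : Matrix (Fin 2) (Fin 2) ℝ} (h : A.IsHermitian)
    {v : Fin 2 → ℝ} (hv : v 0 ^ 2 + v 1 ^ 2 = 1) {m M : ℝ} (hA : A.mulVec v = m • v)
    (htr : m + M = A 0 0 + A 1 1) :
    A 0 0 = m + (M - m) * v 1 ^ 2 ∧ A 0 1 = -((M - m) * (v 0 * v 1)) ∧
      A 1 0 = -((M - m) * (v 0 * v 1)) ∧ A 1 1 = m + (M - m) * v 0 ^ 2 := by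
  have hs : A 1 0 = A 0 1 := by simpa using h.apply 0 1
  have h0 := congrFun hA 0
  have h1 := congrFun hA 1
  simp only [mulVec, dotProduct, Fin.sum_univ_two, Pi.smul_apply, smul_eq_mul, hs] at h0 h1
  have e00 : A 0 0 = m + (M - m) * v 1 ^ 2 := by
    linear_combination (-A 0 0 + m) * hv + v 0 * h0 - v 1 * h1 - v 1 ^ 2 * htr
  have e01 : A 0 1 = -((M - m) * (v 0 * v 1)) := by
    linear_combination (-A 0 1) * hv + v 1 * h0 + v 0 * h1 + v 0 * v 1 * htr
  exact ⟨e00, e01, hs.trans e01, by linear_combination -htr - e00 - (M - m) * hv⟩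

theorem dotProduct_unitize_sq (u p : Fin 2 → ℝ) :
    (unitize u 0 * p 0 + unitize u 1 * p 1) ^ 2 =
      (u 0 * p 0 + u 1 * p 1) ^ 2 / (u 0 ^ 2 + u 1 ^ 2) := by
  have hn : 0 ≤ u 0 ^ 2 + u 1 ^ 2 := by positivity
  simp only [unitize, Fin.sum_univ_two, Pi.smul_apply, smul_eq_mul]
  rw [mul_assoc, mul_assoc, ← mul_add, mul_pow, inv_pow, Real.sq_sqrt hn]
  field

theorem unitize_sq_add_sq {u : Fin 2 → ℝ} (hu : 0 < u 0 ^ 2 + u 1 ^ 2) :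
    unitize u 0 ^ 2 + unitize u 1 ^ 2 = 1 := by
  simp only [unitize, Fin.sum_univ_two, Pi.smul_apply, smul_eq_mul]
  rw [mul_pow, mul_pow, ← mul_add, inv_pow, Real.sq_sqrt hu.le, inv_mul_cancel₀ hu.ne']

/-- In an orthonormal frame `(w, v)`, the sum of the squared forms along `x w + (y ± s) v`, weighted by
`1 / (1 + s² ± 2 s y)`, dominates `2 s² / (1 + s²)` times the form `β²` along `v`. -/
theorem sum_sq_div_ge (x : ℝ) {y s : ℝ} (hp : 0 < 1 + s ^ 2 + 2 * s * y)
    (hm : 0 < 1 + s ^ 2 - 2 * s * y) (α β : ℝ) :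
    2 * s ^ 2 / (1 + s ^ 2) * β ^ 2 ≤
      (x * α + (y + s) * β) ^ 2 / (1 + s ^ 2 + 2 * s * y) +
        (x * α + (y - s) * β) ^ 2 / (1 + s ^ 2 - 2 * s * y) := by
  have hs : 0 < 1 + s ^ 2 := by positivity
  have key : (x * α + (y + s) * β) ^ 2 / (1 + s ^ 2 + 2 * s * y) +
      (x * α + (y - s) * β) ^ 2 / (1 + s ^ 2 - 2 * s * y) - 2 * s ^ 2 / (1 + s ^ 2) * β ^ 2 =
      2 * (x * (1 + s ^ 2) * α + y * (1 - s ^ 2) * β) ^ 2 /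
        ((1 + s ^ 2 + 2 * s * y) * (1 + s ^ 2 - 2 * s * y) * (1 + s ^ 2)) := by
    have hp' := hp.ne'
    have hm' := hm.ne'
    have hs' := hs.ne'
    rw [div_add_div _ _ hp' hm', div_mul_eq_mul_div, div_sub_div _ _ (mul_ne_zero hp' hm') hs']
    congr 1
    ring
  have : 0 ≤ 2 * (x * (1 + s ^ 2) * α + y * (1 - s ^ 2) * β) ^ 2 /
      ((1 + s ^ 2 + 2 * s * y) * (1 + s ^ 2 - 2 * s * y) * (1 + s ^ 2)) := by positivity
  linarith

/-- The scalar step of the recursion: `m`, `M` are the old eigenvalues, `m'`, `M'` the new ones,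
`w` the weight. -/
theorem two_mul_le_sq_of_step {m M m' M' w b : ℝ} (hm2 : 2 ≤ m)
    (hinv : 2 * M ≤ m ^ 2) (hw : 0 ≤ w) (hwm : 8 * w ≤ m * (m - 2))
    (htr : m' + M' = m + M + 2 * w) (hb0 : 0 ≤ b) (hb1 : b ≤ 1) (hmM : m ≤ M)
    (hlow : m + (M - m) * (1 - b) + w * (2 / (m + 1) * b) ≤ m') : 2 * M' ≤ m' ^ 2 := by
  set e := w * (2 / (m + 1)) with he
  have hm1 : 0 < m + 1 := by linarith
  have he' : e * (m + 1) = 2 * w := by rw [he]; field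
  have he0 : 0 ≤ e := by positivity
  have hlow' : m + (M - m) * (1 - b) + e * b ≤ m' := by rw [he]; linarith
  have hge : m ≤ m' := by nlinarith [mul_nonneg he0 hb0]
  by_cases hG : e ≤ M - m
  · have h1 : m + e ≤ m' := by nlinarith
    nlinarith
  · have hG' : M ≤ m + e := by linarith
    have h3 : m + 2 * e + 4 * w ≤ m ^ 2 - m := by nlinarith
    nlinarith

/-- One step of the design matrix recursion. -/
theorem design_step {A B : Matrix (Fin 2) (Fin 2) ℝ} (hA : A.IsHermitian) (hB : B.IsHermitian)
    {c v p ap am : Fin 2 → ℝ} {w : ℝ} (hc : c 0 ^ 2 + c 1 ^ 2 = 1)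
    (hv : v 0 ^ 2 + v 1 ^ 2 = 1)
    (hp : p 0 ^ 2 + p 1 ^ 2 = 1) (hvA : A.mulVec v = matLamMin A • v)
    (hpB : B.mulVec p = matLamMin B • p)
    (hap : ap = unitize (c + (Real.sqrt (matLamMin A))⁻¹ • v))
    (ham : am = unitize (c - (Real.sqrt (matLamMin A))⁻¹ • v))
    (hBA : B = A + w • (vecMulVec ap ap + vecMulVec am am))
    (hm2 : 2 ≤ matLamMin A) (hinv : 2 * matLamMax A ≤ matLamMin A ^ 2)
    (hw : 0 ≤ w) (hwm : 8 * w ≤ matLamMin A * (matLamMin A - 2)) :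
    matLamMin A ≤ matLamMin B ∧ 2 * matLamMax B ≤ matLamMin B ^ 2 := by
  have htrA := matLamMin_add_matLamMax hA
  have htrB := matLamMin_add_matLamMax hB
  have hmM := matLamMin_le_matLamMax hA
  obtain ⟨e00, e01, e10, e11⟩ := entries_of_unit_eigenvector hA hv hvA htrA
  set m := matLamMin A
  set M := matLamMax A
  set s := (Real.sqrt m)⁻¹ with hs
  have hs2 : s ^ 2 = m⁻¹ := by rw [hs, inv_pow, Real.sq_sqrt (by linarith)]
  have hs2' : s ^ 2 ≤ 1 / 2 := by
    rw [hs2, inv_le_comm₀ (by linarith) (by norm_num)]; norm_num; exact hm2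
  have hδ : 2 * s ^ 2 / (1 + s ^ 2) = 2 / (m + 1) := by
    rw [hs2]; field
  set x := -v 1 * c 0 + v 0 * c 1 with hx
  set y := v 0 * c 0 + v 1 * c 1 with hy
  set α := -v 1 * p 0 + v 0 * p 1 with hα
  set β := v 0 * p 0 + v 1 * p 1 with hβ
  have hxy : x ^ 2 + y ^ 2 = 1 := by
    rw [hx, hy]; linear_combination (c 0 ^ 2 + c 1 ^ 2) * hv + hc
  have hαβ : α ^ 2 + β ^ 2 = 1 := by
    rw [hα, hβ]; linear_combination (p 0 ^ 2 + p 1 ^ 2) * hv + hp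
  have hNp : 0 < 1 + s ^ 2 + 2 * s * y := by linarith [sq_nonneg (3 * s + 2 * y), sq_nonneg x]
  have hNm : 0 < 1 + s ^ 2 - 2 * s * y := by linarith [sq_nonneg (3 * s - 2 * y), sq_nonneg x]
  have nP : (c + s • v) 0 ^ 2 + (c + s • v) 1 ^ 2 = 1 + s ^ 2 + 2 * s * y := by
    simp only [Pi.add_apply, Pi.smul_apply, smul_eq_mul, hy]
    linear_combination hc + s ^ 2 * hv
  have nM : (c - s • v) 0 ^ 2 + (c - s • v) 1 ^ 2 = 1 + s ^ 2 - 2 * s * y := by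
    simp only [Pi.sub_apply, Pi.smul_apply, smul_eq_mul, hy]
    linear_combination hc + s ^ 2 * hv
  have dP : (c + s • v) 0 * p 0 + (c + s • v) 1 * p 1 = x * α + (y + s) * β := by
    simp only [Pi.add_apply, Pi.smul_apply, smul_eq_mul, hx, hy, hα, hβ]
    linear_combination -(c 0 * p 0 + c 1 * p 1) * hv
  have dM : (c - s • v) 0 * p 0 + (c - s • v) 1 * p 1 = x * α + (y - s) * β := by
    simp only [Pi.sub_apply, Pi.smul_apply, smul_eq_mul, hx, hy, hα, hβ]
    linear_combination -(c 0 * p 0 + c 1 * p 1) * hv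
  have uP := unitize_sq_add_sq (nP ▸ hNp)
  have uM := unitize_sq_add_sq (nM ▸ hNm)
  have qP := dotProduct_unitize_sq (c + s • v) p
  have qM := dotProduct_unitize_sq (c - s • v) p
  rw [dP, nP, ← hap] at qP
  rw [dM, nM, ← ham] at qM
  rw [← hap] at uP
  rw [← ham] at uM
  have hcore := sum_sq_div_ge x hNp hNm α β
  rw [← qP, ← qM, hδ] at hcore
  have entry : ∀ i j, B i j = A i j + w * (ap i * ap j + am i * am j) := by
    intro i j
    simp [hBA, vecMulVec_apply, mul_add]
  have h0 := congrFun hpB 0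
  have h1 := congrFun hpB 1
  simp only [mulVec, dotProduct, Fin.sum_univ_two, Pi.smul_apply, smul_eq_mul, entry, e00, e01,
    e10, e11] at h0 h1
  have hquad : matLamMin B = m + (M - m) * α ^ 2 +
      w * ((ap 0 * p 0 + ap 1 * p 1) ^ 2 + (am 0 * p 0 + am 1 * p 1) ^ 2) := by
    rw [hα]
    linear_combination (m - matLamMin B) * hp - p 0 * h0 - p 1 * h1
  have htr : matLamMin B + matLamMax B = m + M + 2 * w := by
    rw [htrB, entry, entry, htrA]
    linear_combination w * uP + w * uM
  have hlow : m + (M - m) * (1 - β ^ 2) + w * (2 / (m + 1) * β ^ 2) ≤ matLamMin B := by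
    rw [hquad, show 1 - β ^ 2 = α ^ 2 by linarith]
    gcongr
  refine ⟨?_, two_mul_le_sq_of_step hm2 hinv hw hwm htr (sq_nonneg β)
    (by linarith [sq_nonneg α]) hmM hlow⟩
  rw [hquad]
  have : 0 ≤ (M - m) * α ^ 2 := mul_nonneg (by linarith) (sq_nonneg α)
  have : 0 ≤ w * ((ap 0 * p 0 + ap 1 * p 1) ^ 2 + (am 0 * p 0 + am 1 * p 1) ^ 2) := by positivity
  linarith

/-- Control of the eigenvalues of the design matrix on the circle: with
`V₀ = λ₀ I`, `λ₀ ≥ 4√2 C + 2`, and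
`V_{t+1} = V_t + ω(V_t)(a⁺_{t+1}(a⁺_{t+1})ᵀ + a⁻_{t+1}(a⁻_{t+1})ᵀ)` where
`a±_{t+1}` are the normalizations of `c_t ± v_t / √(λ_min(V_t))` for a unit
`λ_min`-eigenvector `v_t` of `V_t` and `0 ≤ ω(X) ≤ C √(λ_max X)` on PSD matrices,
one has `λ_min(V_t) ≥ √(2 λ_max(V_t))` for all `t`. -/
theorem design_matrix_eigenvalues_dim_two
    (c : ℕ → Fin 2 → ℝ) (hc : ∀ t, ∑ i, c t i ^ 2 = 1)
    (C : ℝ) (hC : 0 < C)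
    (ω : Matrix (Fin 2) (Fin 2) ℝ → ℝ)
    (hω : ∀ X : Matrix (Fin 2) (Fin 2) ℝ, X.PosSemidef →
      0 ≤ ω X ∧ ω X ≤ C * Real.sqrt (matLamMax X))
    (lam0 : ℝ) (hlam0 : 4 * Real.sqrt 2 * C + 2 ≤ lam0)
    (V : ℕ → Matrix (Fin 2) (Fin 2) ℝ)
    (v : ℕ → Fin 2 → ℝ)
    (hv_unit : ∀ t, ∑ i, v t i ^ 2 = 1)
    (hv_eig : ∀ t, (V t).mulVec (v t) = matLamMin (V t) • v t)
    (aplus aminus : ℕ → Fin 2 → ℝ)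
    (hap : ∀ t, aplus t = unitize (c t + (Real.sqrt (matLamMin (V t)))⁻¹ • v t))
    (ham : ∀ t, aminus t = unitize (c t - (Real.sqrt (matLamMin (V t)))⁻¹ • v t))
    (hV0 : V 0 = lam0 • (1 : Matrix (Fin 2) (Fin 2) ℝ))
    (hVrec : ∀ t, V (t + 1) = V t + ω (V t) •
      (vecMulVec (aplus t) (aplus t) + vecMulVec (aminus t) (aminus t))) :
    ∀ t, Real.sqrt (2 * matLamMax (V t)) ≤ matLamMin (V t) := by
  simp only [Fin.sum_univ_two] at hc hv_unit
  have hr2 : 0 < Real.sqrt 2 := by positivity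
  have hlam2 : 2 ≤ lam0 := by nlinarith [mul_pos hr2 hC]
  have main : ∀ t, (V t).PosSemidef ∧ lam0 ≤ matLamMin (V t) ∧
      2 * matLamMax (V t) ≤ matLamMin (V t) ^ 2 := by
    intro t
    induction t with
    | zero =>
      have hpsd : (V 0).PosSemidef := by
        rw [hV0]
        exact PosSemidef.one.smul (by linarith)
      have hmin : matLamMin (V 0) = lam0 := by
        have h := hv_eig 0
        have h0 := congrFun h 0
        have h1 := congrFun h 1
        simp only [mulVec, dotProduct, Fin.sum_univ_two, Pi.smul_apply, smul_eq_mul,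
          congrFun (congrFun hV0 _) _, Matrix.smul_apply, one_apply] at h0 h1
        norm_num at h0 h1
        have hu := hv_unit 0
        grind
      have hsum := matLamMin_add_matLamMax hpsd.1
      have hmax : matLamMax (V 0) = lam0 := by
        rw [hmin] at hsum
        simp [hV0] at hsum
        rw [hV0]
        linarith
      refine ⟨hpsd, hmin.ge, ?_⟩
      rw [hmin, hmax]
      nlinarith
    | succ t ih =>
      obtain ⟨hpsd, hmin, hinv⟩ := ih
      obtain ⟨hw0, hw⟩ := hω (V t) hpsd
      have hrank : ∀ a : Fin 2 → ℝ, (vecMulVec a a).PosSemidef := fun a => by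
        simpa using posSemidef_vecMulVec_self_star a
      have hpsd' : (V (t + 1)).PosSemidef := by
        rw [hVrec t]
        exact hpsd.add (((hrank _).add (hrank _)).smul hw0)
      have hwm : 8 * ω (V t) ≤ matLamMin (V t) * (matLamMin (V t) - 2) := by
        have hsqrt : Real.sqrt 2 * Real.sqrt (matLamMax (V t)) ≤ matLamMin (V t) := by
          rw [← Real.sqrt_mul (by norm_num)]
          exact Real.sqrt_le_iff.mpr ⟨by linarith, hinv⟩
        have hsq2 : Real.sqrt 2 * Real.sqrt 2 = 2 := Real.mul_self_sqrt (by norm_num)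
        calc 8 * ω (V t) ≤ 8 * (C * Real.sqrt (matLamMax (V t))) := by linarith
          _ = (Real.sqrt 2 * Real.sqrt (matLamMax (V t))) * (4 * Real.sqrt 2 * C) := by
            linear_combination (-4 * C * Real.sqrt (matLamMax (V t))) * hsq2
          _ ≤ matLamMin (V t) * (matLamMin (V t) - 2) := by
            apply mul_le_mul hsqrt <;> first | positivity | linarith
      obtain ⟨h1, h2⟩ := design_step hpsd.1 hpsd'.1 (hc t) (hv_unit t) (hv_unit (t + 1))
        (hv_eig t) (hv_eig (t + 1)) (hap t) (ham t) (hVrec t) (hlam2.trans hmin) hinv hw0 hwm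
      exact ⟨hpsd', hmin.trans h1, h2⟩
  intro t
  obtain ⟨-, h1, h2⟩ := main t
  exact Real.sqrt_le_iff.mpr ⟨by linarith, h2⟩
end

section
/- Let d ≥ 2, let (c_t)_{t≥0} ⊂ S^{d-1} be a sequence of unit vectors in ℝ^d, let C > 0, and let ω be a function from real symmetric positive semidefinite d×d matrices to nonnegative reals satisfying ω(X) ≤ C √(λ_max(X)) for all such X. Let λ₀ ≥ max{ 2, √(2/(3(d−1))) · 2dC + 2/(3(d−1)) } and define V₀ := λ₀ I and V_{t+1} := V_t + ω(V_t) Σ_{i=1}^{d−1} ( a⁺_{t+1,i}(a⁺_{t+1,i})ᵀ + a⁻_{t+1,i}(a⁻_{t+1,i})ᵀ ), where for each t the vectors v_{t,1}, …, v_{t,d} form an orthonormal basis of eigenvectors of V_t with eigenvalues λ₁(V_t) ≤ … ≤ λ_d(V_t), and a±_{t+1,i} is the normalization of c_t ± (1/√(λ_min(V_t))) v_{t,i} for i = 1, …, d−1. Then for all t ≥ 0, λ_min(V_t) ≥ √( (2/(3(d−1))) · λ_max(V_t) ). -/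
open Matrix
open scoped Classical

section QuadraticForms

variable {m : ℕ}

lemma sum_dotProduct_mul_dotProduct_of_orthonormal {v : Fin m → Fin m → ℝ}
    (hv : ∀ i j : Fin m, ∑ k, v i k * v j k = if i = j then 1 else 0) (x y : Fin m → ℝ) :
    ∑ i, (v i ⬝ᵥ x) * (v i ⬝ᵥ y) = x ⬝ᵥ y := by
  have h1 : Matrix.of v * (Matrix.of v)ᵀ = 1 := by
    ext i j
    simp [Matrix.mul_apply, Matrix.one_apply, hv]
  have h2 : (Matrix.of v)ᵀ * Matrix.of v = 1 := mul_eq_one_comm.mp h1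
  calc ∑ i, (v i ⬝ᵥ x) * (v i ⬝ᵥ y) = (Matrix.of v *ᵥ x) ⬝ᵥ (Matrix.of v *ᵥ y) := rfl
    _ = x ⬝ᵥ (((Matrix.of v)ᵀ * Matrix.of v) *ᵥ y) := by
      rw [← Matrix.mulVec_mulVec, Matrix.dotProduct_mulVec, Matrix.dotProduct_mulVec,
        Matrix.vecMul_transpose, Matrix.dotProduct_mulVec]
    _ = x ⬝ᵥ y := by rw [h2, Matrix.one_mulVec]

lemma sum_sq_dotProduct_of_orthonormal {v : Fin m → Fin m → ℝ}
    (hv : ∀ i j : Fin m, ∑ k, v i k * v j k = if i = j then 1 else 0) (x : Fin m → ℝ) :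
    ∑ i, (v i ⬝ᵥ x) ^ 2 = x ⬝ᵥ x := by
  simpa only [sq] using sum_dotProduct_mul_dotProduct_of_orthonormal hv x x

lemma dotProduct_self_of_orthonormal {v : Fin m → Fin m → ℝ}
    (hv : ∀ i j : Fin m, ∑ k, v i k * v j k = if i = j then 1 else 0) (i : Fin m) :
    v i ⬝ᵥ v i = 1 := by
  simpa [dotProduct] using hv i i

lemma quadraticForm_eq_sum_eigenbasis {A : Matrix (Fin m) (Fin m) ℝ} (hA : A.IsSymm)
    {v : Fin m → Fin m → ℝ} {μ : Fin m → ℝ}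
    (hv : ∀ i j : Fin m, ∑ k, v i k * v j k = if i = j then 1 else 0)
    (heig : ∀ i, A *ᵥ v i = μ i • v i) (x : Fin m → ℝ) :
    x ⬝ᵥ (A *ᵥ x) = ∑ i, μ i * (v i ⬝ᵥ x) ^ 2 := by
  rw [← sum_dotProduct_mul_dotProduct_of_orthonormal hv]
  refine Finset.sum_congr rfl fun i _ => ?_
  have h : v i ⬝ᵥ (A *ᵥ x) = μ i * (v i ⬝ᵥ x) := by
    rw [Matrix.dotProduct_mulVec, ← Matrix.mulVec_transpose, hA.eq, heig, smul_dotProduct,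
      smul_eq_mul]
  rw [h]
  ring

lemma eigenvalue_eq_quadraticForm {A : Matrix (Fin m) (Fin m) ℝ}
    {v : Fin m → Fin m → ℝ} {μ : Fin m → ℝ}
    (hv : ∀ i j : Fin m, ∑ k, v i k * v j k = if i = j then 1 else 0)
    (heig : ∀ i, A *ᵥ v i = μ i • v i) (i : Fin m) :
    μ i = v i ⬝ᵥ (A *ᵥ v i) := by
  rw [heig, dotProduct_smul, dotProduct_self_of_orthonormal hv, smul_eq_mul, mul_one]

lemma quadraticForm_le_of_eigenvalues_le {A : Matrix (Fin m) (Fin m) ℝ} (hA : A.IsSymm)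
    {v : Fin m → Fin m → ℝ} {μ : Fin m → ℝ}
    (hv : ∀ i j : Fin m, ∑ k, v i k * v j k = if i = j then 1 else 0)
    (heig : ∀ i, A *ᵥ v i = μ i • v i) {b : ℝ} (hb : ∀ i, μ i ≤ b) (x : Fin m → ℝ) :
    x ⬝ᵥ (A *ᵥ x) ≤ b * (x ⬝ᵥ x) := by
  rw [quadraticForm_eq_sum_eigenbasis hA hv heig, ← sum_sq_dotProduct_of_orthonormal hv x,
    Finset.mul_sum]
  exact Finset.sum_le_sum fun i _ => mul_le_mul_of_nonneg_right (hb i) (sq_nonneg _)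

lemma posSemidef_of_eigenbasis_nonneg {A : Matrix (Fin m) (Fin m) ℝ} (hA : A.IsSymm)
    {v : Fin m → Fin m → ℝ} {μ : Fin m → ℝ}
    (hv : ∀ i j : Fin m, ∑ k, v i k * v j k = if i = j then 1 else 0)
    (heig : ∀ i, A *ᵥ v i = μ i • v i) (hμ : ∀ i, 0 ≤ μ i) : A.PosSemidef := by
  refine Matrix.PosSemidef.of_dotProduct_mulVec_nonneg ?_ fun x => ?_
  · rw [Matrix.IsHermitian, Matrix.conjTranspose_eq_transpose_of_trivial, hA.eq]
  · rw [star_trivial, quadraticForm_eq_sum_eigenbasis hA hv heig]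
    exact Finset.sum_nonneg fun i _ => mul_nonneg (hμ i) (sq_nonneg _)

lemma matLamMax_le_of_eigenvalues_le [NeZero m] {A : Matrix (Fin m) (Fin m) ℝ}
    (hA : A.IsSymm) {v : Fin m → Fin m → ℝ} {μ : Fin m → ℝ}
    (hv : ∀ i j : Fin m, ∑ k, v i k * v j k = if i = j then 1 else 0)
    (heig : ∀ i, A *ᵥ v i = μ i • v i) {b : ℝ} (hb : ∀ i, μ i ≤ b) : matLamMax A ≤ b := by
  have hH : A.IsHermitian := by
    rw [Matrix.IsHermitian, Matrix.conjTranspose_eq_transpose_of_trivial, hA.eq]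
  rw [matLamMax, dif_pos hH]
  refine ciSup_le fun i => ?_
  have h1 := hH.mulVec_eigenvectorBasis i
  have h2 : (hH.eigenvectorBasis i).ofLp ⬝ᵥ (hH.eigenvectorBasis i).ofLp = 1 := by
    have h := hH.eigenvectorBasis.orthonormal.1 i
    rw [EuclideanSpace.norm_eq, Real.sqrt_eq_one] at h
    simpa [dotProduct, sq] using h
  have h3 := quadraticForm_le_of_eigenvalues_le hA hv heig hb (hH.eigenvectorBasis i).ofLp
  rwa [h1, dotProduct_smul, h2, smul_eq_mul, mul_one, mul_one] at h3

lemma sq_dotProduct_le (u x : Fin m → ℝ) : (u ⬝ᵥ x) ^ 2 ≤ (u ⬝ᵥ u) * (x ⬝ᵥ x) := by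
  simpa [dotProduct, sq] using Finset.sum_mul_sq_le_sq_mul_sq Finset.univ u x

lemma dotProduct_self_nonneg_real (u : Fin m → ℝ) : 0 ≤ u ⬝ᵥ u :=
  Finset.sum_nonneg fun i _ => mul_self_nonneg (u i)

lemma sq_unitize_dotProduct (u x : Fin m → ℝ) :
    (unitize u ⬝ᵥ x) ^ 2 = (u ⬝ᵥ x) ^ 2 / (u ⬝ᵥ u) := by
  have h : ∑ i, u i ^ 2 = u ⬝ᵥ u := by simp [dotProduct, sq]
  rw [unitize, h, smul_dotProduct, smul_eq_mul, mul_pow, inv_pow,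
    Real.sq_sqrt (dotProduct_self_nonneg_real u), div_eq_inv_mul]

lemma sq_unitize_dotProduct_le (u x : Fin m → ℝ) : (unitize u ⬝ᵥ x) ^ 2 ≤ x ⬝ᵥ x := by
  rw [sq_unitize_dotProduct]
  refine div_le_of_le_mul₀ (dotProduct_self_nonneg_real u) (dotProduct_self_nonneg_real x) ?_
  rw [mul_comm]
  exact sq_dotProduct_le u x

lemma div_le_sq_unitize_dotProduct {u : Fin m → ℝ} {b : ℝ} (hu : u ⬝ᵥ u ≤ b)
    (x : Fin m → ℝ) : (u ⬝ᵥ x) ^ 2 / b ≤ (unitize u ⬝ᵥ x) ^ 2 := by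
  rw [sq_unitize_dotProduct]
  rcases (dotProduct_self_nonneg_real u).eq_or_lt with h | h
  · have h0 : (u ⬝ᵥ x) ^ 2 = 0 := by
      refine le_antisymm ?_ (sq_nonneg _)
      simpa [← h] using sq_dotProduct_le u x
    simp [h0]
  · exact div_le_div_of_nonneg_left (sq_nonneg _) h hu

lemma le_sq_unitize_add_sq_unitize {c w : Fin m → ℝ} (hc : c ⬝ᵥ c = 1) (hw : w ⬝ᵥ w = 1)
    {s : ℝ} (hs : 0 ≤ s) (hs2 : s ^ 2 ≤ 1 / 2) (x : Fin m → ℝ) :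
    2 / 3 * s ^ 2 * (w ⬝ᵥ x) ^ 2 ≤
      (unitize (c + s • w) ⬝ᵥ x) ^ 2 + (unitize (c - s • w) ⬝ᵥ x) ^ 2 := by
  have hcw : (c ⬝ᵥ w) ^ 2 ≤ 1 := by simpa [hc, hw] using sq_dotProduct_le c w
  obtain ⟨h1, h2⟩ := abs_le.mp ((sq_le_one_iff_abs_le_one _).mp hcw)
  have hs3 : s ≤ 3 / 4 := by nlinarith
  have hp : (c + s • w) ⬝ᵥ (c + s • w) ≤ 3 := by
    simp only [add_dotProduct, dotProduct_add, smul_dotProduct, dotProduct_smul, hc, hw,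
      smul_eq_mul, dotProduct_comm w c]
    nlinarith
  have hm : (c - s • w) ⬝ᵥ (c - s • w) ≤ 3 := by
    simp only [sub_dotProduct, dotProduct_sub, smul_dotProduct, dotProduct_smul, hc, hw,
      smul_eq_mul, dotProduct_comm w c]
    nlinarith
  refine le_trans ?_ (add_le_add (div_le_sq_unitize_dotProduct hp x)
    (div_le_sq_unitize_dotProduct hm x))
  simp only [add_dotProduct, sub_dotProduct, smul_dotProduct, smul_eq_mul]
  nlinarith [sq_nonneg (c ⬝ᵥ x)]

lemma quadraticForm_vecMulVec_self (a x : Fin m → ℝ) :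
    x ⬝ᵥ (vecMulVec a a *ᵥ x) = (a ⬝ᵥ x) ^ 2 := by
  rw [Matrix.vecMulVec_mulVec, dotProduct_smul, dotProduct_comm x a]
  simp [sq]

lemma quadraticForm_rankOne_update {n : ℕ} (A : Matrix (Fin m) (Fin m) ℝ) (w : ℝ)
    (p q : Fin n → Fin m → ℝ) (x : Fin m → ℝ) :
    x ⬝ᵥ ((A + w • ∑ i, (vecMulVec (p i) (p i) + vecMulVec (q i) (q i))) *ᵥ x) =
      x ⬝ᵥ (A *ᵥ x) + w * ∑ i, ((p i ⬝ᵥ x) ^ 2 + (q i ⬝ᵥ x) ^ 2) := by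
  simp only [Matrix.add_mulVec, Matrix.smul_mulVec, Matrix.sum_mulVec, dotProduct_add,
    dotProduct_smul, dotProduct_sum, smul_eq_mul, quadraticForm_vecMulVec_self]

lemma isSymm_rankOne_update {n : ℕ} {A : Matrix (Fin m) (Fin m) ℝ} (hA : A.IsSymm) (w : ℝ)
    (p q : Fin n → Fin m → ℝ) :
    (A + w • ∑ i, (vecMulVec (p i) (p i) + vecMulVec (q i) (q i))).IsSymm := by
  rw [Matrix.IsSymm, Matrix.transpose_add, Matrix.transpose_smul, Matrix.transpose_sum, hA.eq]
  simp [Matrix.transpose_add, Matrix.transpose_vecMulVec]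

end QuadraticForms

/-- The two alternatives for the new smallest eigenvalue: it gains `2w/(3l)` over the old
smallest eigenvalue `l`, or it exceeds the old largest eigenvalue `L`. -/
lemma mul_le_sq_of_convex_lower_bound {n k C l0 l L w l' L' p : ℝ} (hn : 1 ≤ n)
    (hk : k * (3 * n) = 2) (hC : 0 < C) (hl0 : 2 ≤ l0)
    (hl0' : √k * (2 * (n + 1) * C) + k ≤ l0) (hl : l0 ≤ l) (hlL : l ≤ L)
    (hinv : k * L ≤ l ^ 2) (hw : 0 ≤ w) (hwC : w ≤ C * √L)
    (hp : 0 ≤ p) (hp1 : p ≤ 1) (hL' : L' ≤ L + w * (2 * n))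
    (hl' : (1 - p) * (l + 2 * w / (3 * l)) + p * L ≤ l') : k * L' ≤ l' ^ 2 := by
  have hk0 : 0 < k := by
    by_contra! h
    nlinarith
  have hlpos : 0 < l := by linarith
  have hkL : k * L' ≤ k * L + 4 / 3 * w := by
    calc k * L' ≤ k * (L + w * (2 * n)) := mul_le_mul_of_nonneg_left hL' hk0.le
      _ = k * L + k * (3 * n) * (2 / 3 * w) := by ring
      _ = k * L + 4 / 3 * w := by rw [hk]; ring
  have hg : 0 ≤ 2 * w / (3 * l) := by positivity
  refine hkL.trans ?_
  rcases le_total (l + 2 * w / (3 * l)) L with h | h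
  · have h1 : l + 2 * w / (3 * l) ≤ l' := by nlinarith
    have h2 : l * (2 * w / (3 * l)) = 2 / 3 * w := by field_simp
    nlinarith
  · have h1 : L ≤ l' := by nlinarith
    have h2 : L ^ 2 ≤ l' ^ 2 := by nlinarith
    have hkL1 : 1 ≤ √k * √L * (n + 1) := by
      rw [← Real.sqrt_mul hk0.le]
      have h3 : 1 ≤ (√(k * L) * (n + 1)) ^ 2 := by
        rw [mul_pow, Real.sq_sqrt (by nlinarith)]
        have h4 : 2 * k ≤ k * L := by nlinarith
        nlinarith
      exact (one_le_sq_iff₀ (by positivity)).mp h3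
    have hs := Real.sq_sqrt (show 0 ≤ L by linarith)
    have h5 : 2 * (C * √L) ≤ √k * (2 * (n + 1) * C) * L := by
      calc 2 * (C * √L) = 2 * (C * √L) * 1 := by ring
        _ ≤ 2 * (C * √L) * (√k * √L * (n + 1)) := by gcongr
        _ = √k * (2 * (n + 1) * C) * √L ^ 2 := by ring
        _ = √k * (2 * (n + 1) * C) * L := by rw [hs]
    nlinarith

lemma eigenvalue_invariant_step {n : ℕ} (hn : 1 ≤ n) {k C l0 w : ℝ}
    (hk : k * (3 * n) = 2) (hC : 0 < C) (hl0 : 2 ≤ l0)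
    (hl0' : √k * (2 * (n + 1) * C) + k ≤ l0)
    {A B : Matrix (Fin (n + 1)) (Fin (n + 1)) ℝ} (hA : A.IsSymm)
    {c : Fin (n + 1) → ℝ} (hc : c ⬝ᵥ c = 1)
    {μ ν : Fin (n + 1) → ℝ} {v u : Fin (n + 1) → Fin (n + 1) → ℝ} (hμ : Monotone μ)
    (hv : ∀ i j, ∑ k, v i k * v j k = if i = j then 1 else 0)
    (hu : ∀ i j, ∑ k, u i k * u j k = if i = j then 1 else 0)
    (heigA : ∀ i, A *ᵥ v i = μ i • v i) (heigB : ∀ i, B *ᵥ u i = ν i • u i)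
    {p q : Fin n → Fin (n + 1) → ℝ}
    (hp : ∀ i, p i = unitize (c + (√(μ 0))⁻¹ • v i.castSucc))
    (hq : ∀ i, q i = unitize (c - (√(μ 0))⁻¹ • v i.castSucc))
    (hB : B = A + w • ∑ i, (vecMulVec (p i) (p i) + vecMulVec (q i) (q i)))
    (hw : 0 ≤ w) (hwC : w ≤ C * √(μ (Fin.last n)))
    (hl : l0 ≤ μ 0) (hinv : k * μ (Fin.last n) ≤ μ 0 ^ 2) :
    l0 ≤ ν 0 ∧ k * ν (Fin.last n) ≤ ν 0 ^ 2 := by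
  have hpos : 0 < μ 0 := by linarith
  have hquad (x) : x ⬝ᵥ (B *ᵥ x) =
      x ⬝ᵥ (A *ᵥ x) + w * ∑ i, ((p i ⬝ᵥ x) ^ 2 + (q i ⬝ᵥ x) ^ 2) := by
    rw [hB, quadraticForm_rankOne_update]
  have hupper : ν (Fin.last n) ≤ μ (Fin.last n) + w * (2 * n) := by
    rw [eigenvalue_eq_quadraticForm hu heigB, hquad]
    have hone := dotProduct_self_of_orthonormal hu (Fin.last n)
    set x := u (Fin.last n)
    refine add_le_add ?_ (mul_le_mul_of_nonneg_left ?_ hw)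
    · simpa [hone] using quadraticForm_le_of_eigenvalues_le hA hv heigA
        (fun i => hμ (Fin.le_last i)) x
    · calc ∑ i, ((p i ⬝ᵥ x) ^ 2 + (q i ⬝ᵥ x) ^ 2) ≤ ∑ _i : Fin n, (2 : ℝ) := by
            refine Finset.sum_le_sum fun i _ => ?_
            rw [hp, hq]
            linarith [sq_unitize_dotProduct_le (c + (√(μ 0))⁻¹ • v i.castSucc) x,
              sq_unitize_dotProduct_le (c - (√(μ 0))⁻¹ • v i.castSucc) x]
        _ = 2 * n := by simp [mul_comm]
  set r := (v (Fin.last n) ⬝ᵥ u 0) ^ 2 with hr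
  have hr0 : 0 ≤ r := sq_nonneg _
  have hsum : ∑ i : Fin n, (v i.castSucc ⬝ᵥ u 0) ^ 2 = 1 - r := by
    have h := sum_sq_dotProduct_of_orthonormal hv (u 0)
    rw [dotProduct_self_of_orthonormal hu, Fin.sum_univ_castSucc] at h
    linarith
  have hr1 : r ≤ 1 := by
    have : 0 ≤ ∑ i : Fin n, (v i.castSucc ⬝ᵥ u 0) ^ 2 :=
      Finset.sum_nonneg fun i _ => sq_nonneg _
    linarith
  have hs2 : ((√(μ 0))⁻¹) ^ 2 = (μ 0)⁻¹ := by rw [inv_pow, Real.sq_sqrt hpos.le]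
  have hlower : (1 - r) * (μ 0 + 2 * w / (3 * μ 0)) + r * μ (Fin.last n) ≤ ν 0 := by
    have h1 : μ 0 * (1 - r) + μ (Fin.last n) * r ≤ u 0 ⬝ᵥ (A *ᵥ u 0) := by
      rw [quadraticForm_eq_sum_eigenbasis hA hv heigA, Fin.sum_univ_castSucc, ← hsum,
        Finset.mul_sum]
      gcongr
      exact hμ (Fin.zero_le _)
    have h2 : 2 / 3 * (μ 0)⁻¹ * (1 - r) ≤
        ∑ i, ((p i ⬝ᵥ u 0) ^ 2 + (q i ⬝ᵥ u 0) ^ 2) := by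
      rw [← hsum, Finset.mul_sum]
      refine Finset.sum_le_sum fun i _ => ?_
      rw [hp, hq, ← hs2]
      refine le_sq_unitize_add_sq_unitize hc (dotProduct_self_of_orthonormal hv _)
        (by positivity) ?_ _
      rw [hs2, one_div]
      exact inv_anti₀ two_pos (hl0.trans hl)
    have h3 := mul_le_mul_of_nonneg_left h2 hw
    rw [eigenvalue_eq_quadraticForm hu heigB, hquad]
    calc _ = μ 0 * (1 - r) + μ (Fin.last n) * r + w * (2 / 3 * (μ 0)⁻¹ * (1 - r)) := by
            field_simp
            ring
      _ ≤ _ := add_le_add h1 h3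
  have hlL : μ 0 ≤ μ (Fin.last n) := hμ (Fin.zero_le _)
  refine ⟨?_, mul_le_sq_of_convex_lower_bound (Nat.one_le_cast.mpr hn) hk hC hl0 hl0' hl hlL
    hinv hw hwC hr0 hr1 hupper hlower⟩
  have hg : 0 ≤ 2 * w / (3 * μ 0) := by positivity
  nlinarith

/-- Control of the eigenvalues of the design matrix in dimension `d ≥ 2`: with
`V₀ = λ₀ I`, `λ₀ ≥ max{2, √(2/(3(d-1))) 2dC + 2/(3(d-1))}`, and
`V_{t+1} = V_t + ω(V_t) Σ_{i<d-1} (a⁺_{t+1,i}(a⁺_{t+1,i})ᵀ + a⁻_{t+1,i}(a⁻_{t+1,i})ᵀ)`,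
where `v_{t,1}, …, v_{t,d}` is an orthonormal eigenbasis of `V_t` with eigenvalues
`μ_t` in nondecreasing order, `a±_{t+1,i}` is the normalization of
`c_t ± v_{t,i}/√(λ_min(V_t))`, and `0 ≤ ω(X) ≤ C √(λ_max X)` on PSD matrices,
one has `λ_min(V_t) ≥ √((2/(3(d-1))) λ_max(V_t))` for all `t`. -/
theorem design_matrix_eigenvalues_general
    (d : ℕ) (hd : 2 ≤ d)
    (c : ℕ → Fin d → ℝ) (hc : ∀ t, ∑ i, c t i ^ 2 = 1)
    (C : ℝ) (hC : 0 < C)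
    (ω : Matrix (Fin d) (Fin d) ℝ → ℝ)
    (hω : ∀ X : Matrix (Fin d) (Fin d) ℝ, X.PosSemidef →
      0 ≤ ω X ∧ ω X ≤ C * Real.sqrt (matLamMax X))
    (lam0 : ℝ)
    (hlam0 : max 2 (Real.sqrt (2 / (3 * ((d : ℝ) - 1))) * (2 * (d : ℝ) * C)
      + 2 / (3 * ((d : ℝ) - 1))) ≤ lam0)
    (V : ℕ → Matrix (Fin d) (Fin d) ℝ)
    (μ : ℕ → Fin d → ℝ) (v : ℕ → Fin d → Fin d → ℝ)
    (hmono : ∀ t, Monotone (μ t))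
    (horth : ∀ t, ∀ i j : Fin d, ∑ k, v t i k * v t j k = if i = j then 1 else 0)
    (heig : ∀ t, ∀ i : Fin d, (V t).mulVec (v t i) = μ t i • v t i)
    (ap am : ℕ → Fin (d - 1) → Fin d → ℝ)
    (hap : ∀ t, ∀ i : Fin (d - 1), ap t i =
      unitize (c t + (Real.sqrt (μ t ⟨0, by omega⟩))⁻¹ •
        v t ⟨i.1, i.2.trans_le (Nat.sub_le d 1)⟩))
    (ham : ∀ t, ∀ i : Fin (d - 1), am t i =
      unitize (c t - (Real.sqrt (μ t ⟨0, by omega⟩))⁻¹ •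
        v t ⟨i.1, i.2.trans_le (Nat.sub_le d 1)⟩))
    (hV0 : V 0 = lam0 • (1 : Matrix (Fin d) (Fin d) ℝ))
    (hVrec : ∀ t, V (t + 1) = V t + ω (V t) •
      ∑ i : Fin (d - 1), (vecMulVec (ap t i) (ap t i) + vecMulVec (am t i) (am t i))) :
    ∀ t, Real.sqrt (2 / (3 * ((d : ℝ) - 1)) * μ t ⟨d - 1, by omega⟩) ≤ μ t ⟨0, by omega⟩ := by
  obtain ⟨n, rfl⟩ : ∃ n, d = n + 1 := ⟨d - 1, by omega⟩
  have hn : 1 ≤ n := by omega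
  have hn' : (1 : ℝ) ≤ n := Nat.one_le_cast.mpr hn
  have hcast : ((n + 1 : ℕ) : ℝ) - 1 = n := by push_cast; ring
  rw [hcast] at hlam0 ⊢
  set k : ℝ := 2 / (3 * (n : ℝ)) with hk_def
  have hk : k * (3 * n) = 2 := by rw [hk_def]; field_simp
  have hk1 : k ≤ 1 := by
    rw [hk_def, div_le_one (by positivity)]
    linarith
  have hl0 : 2 ≤ lam0 := (le_max_left _ _).trans hlam0
  have hl0' : √k * (2 * (n + 1) * C) + k ≤ lam0 := by
    have h := (le_max_right _ _).trans hlam0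
    push_cast at h
    exact h
  have hinv : ∀ t, (V t).IsSymm ∧ lam0 ≤ μ t 0 ∧ k * μ t (Fin.last n) ≤ μ t 0 ^ 2 := by
    intro t
    induction t with
    | zero =>
      have hμ0 (i) : μ 0 i = lam0 := by
        rw [eigenvalue_eq_quadraticForm (horth 0) (heig 0), hV0, Matrix.smul_mulVec,
          Matrix.one_mulVec, dotProduct_smul, dotProduct_self_of_orthonormal (horth 0),
          smul_eq_mul, mul_one]
      refine ⟨?_, (hμ0 0).ge, ?_⟩
      · rw [hV0, Matrix.IsSymm, Matrix.transpose_smul, Matrix.transpose_one]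
      · rw [hμ0, hμ0]
        nlinarith
    | succ t ih =>
      obtain ⟨hsymm, hl, hi⟩ := ih
      have hω' := hω (V t) (posSemidef_of_eigenbasis_nonneg hsymm (horth t) (heig t)
        fun i => by linarith [hmono t (Fin.zero_le i)])
      have hmax : matLamMax (V t) ≤ μ t (Fin.last n) :=
        matLamMax_le_of_eigenvalues_le hsymm (horth t) (heig t)
          fun i => hmono t (Fin.le_last i)
      refine ⟨?_, eigenvalue_invariant_step hn hk hC hl0 hl0' hsymm
        (by simpa [dotProduct, sq] using hc t) (hmono t) (horth t) (horth (t + 1)) (heig t)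
        (heig (t + 1)) (hap t) (ham t) (hVrec t) hω'.1 (hω'.2.trans (by gcongr)) hl hi⟩
      rw [hVrec]
      exact isSymm_rankOne_update hsymm _ _ _
  intro t
  obtain ⟨-, hl, hi⟩ := hinv t
  exact Real.sqrt_le_iff.mpr ⟨show 0 ≤ μ t 0 by linarith, hi⟩
end

section
/- Let c, v ∈ S^{d-1} be unit vectors in ℝ^d and let λ > 1. Define ã± := c ± (1/√λ) v and a± := ã±/‖ã±‖₂. Then ‖a⁺ − c‖₂² ≤ 2/λ and ‖a⁻ − c‖₂² ≤ 2/λ. -/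
open scoped RealInnerProductSpace in
/-- Normalizing a perturbation `c + w` of a unit vector `c` with `‖w‖ < 1` moves it at squared
distance at most `2 ‖w‖ ^ 2` from `c`. -/
theorem norm_normalize_add_sub_sq_le {E : Type*} [NormedAddCommGroup E] [InnerProductSpace ℝ E]
    {c w : E} (hc : ‖c‖ = 1) (hw : ‖w‖ < 1) :
    ‖‖c + w‖⁻¹ • (c + w) - c‖ ^ 2 ≤ 2 * ‖w‖ ^ 2 := by
  have hN : 0 < ‖c + w‖ := by
    have h := norm_sub_le (c + w) w
    rw [add_sub_cancel_right, hc] at h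
    linarith
  have hNsq : ‖c + w‖ ^ 2 = 1 + 2 * ⟪c, w⟫ + ‖w‖ ^ 2 := by
    rw [norm_add_sq_real, hc, one_pow]
  have hp : -‖w‖ ≤ ⟪c, w⟫ := by
    have h := abs_real_inner_le_norm c w
    rw [hc, one_mul] at h
    exact (abs_le.mp h).1
  have hr : 0 ≤ ‖w‖ := norm_nonneg w
  have hr1 : 0 ≤ 1 - ‖w‖ ^ 2 := by nlinarith
  have hsq : (1 - ‖w‖ ^ 2) * ‖c + w‖ ^ 2 ≤ (1 + ⟪c, w⟫) ^ 2 := by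
    rw [hNsq]
    linarith [sq_nonneg (⟪c, w⟫ + ‖w‖ ^ 2)]
  have hcos : (1 - ‖w‖ ^ 2) * ‖c + w‖ ≤ 1 + ⟪c, w⟫ := by
    refine abs_le_of_sq_le_sq' ?_ (by linarith) |>.2
    rw [mul_pow]
    refine le_trans (mul_le_mul_of_nonneg_right ?_ (sq_nonneg _)) hsq
    nlinarith [sq_nonneg ‖w‖]
  have hinner : ⟪‖c + w‖⁻¹ • (c + w), c⟫ = (1 + ⟪c, w⟫) / ‖c + w‖ := by
    rw [real_inner_smul_left, inner_add_left, real_inner_self_eq_norm_sq, hc,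
      real_inner_comm c w, one_pow, div_eq_inv_mul]
  have hunit : ‖‖c + w‖⁻¹ • (c + w)‖ = 1 := by
    rw [norm_smul, norm_inv, norm_norm, inv_mul_cancel₀ hN.ne']
  rw [norm_sub_sq_real, hinner, hunit, hc]
  have h := (le_div_iff₀ hN).mpr hcos
  linarith


/-- For unit vectors `c, v ∈ S^{d-1}` and `λ > 1`, the normalizations `a±` of
`ã± = c ± v/√λ` satisfy `‖a± − c‖² ≤ 2/λ`. -/
theorem dist_unitized_perturbation_le
    {d : ℕ} (c v : EuclideanSpace ℝ (Fin d))
    (hc : ‖c‖ = 1) (hv : ‖v‖ = 1) (lam : ℝ) (hlam : 1 < lam) :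
    ‖‖c + (Real.sqrt lam)⁻¹ • v‖⁻¹ • (c + (Real.sqrt lam)⁻¹ • v) - c‖ ^ 2 ≤ 2 / lam ∧
    ‖‖c - (Real.sqrt lam)⁻¹ • v‖⁻¹ • (c - (Real.sqrt lam)⁻¹ • v) - c‖ ^ 2 ≤ 2 / lam := by
  have hlam0 : 0 < lam := by linarith
  have hnorm : ‖(Real.sqrt lam)⁻¹ • v‖ = (Real.sqrt lam)⁻¹ := by
    rw [norm_smul, hv, mul_one, Real.norm_of_nonneg (by positivity)]
  have hlt : (Real.sqrt lam)⁻¹ < 1 :=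
    inv_lt_one_of_one_lt₀ (Real.lt_sqrt_of_sq_lt (by simpa using hlam))
  have hsq : 2 * (Real.sqrt lam)⁻¹ ^ 2 = 2 / lam := by
    rw [inv_pow, Real.sq_sqrt hlam0.le, div_eq_mul_inv]
  constructor
  · have h := norm_normalize_add_sub_sq_le hc (hnorm.trans_lt hlt)
    rwa [hnorm, hsq] at h
  · have h := norm_normalize_add_sub_sq_le hc
      ((norm_neg ((Real.sqrt lam)⁻¹ • v)).trans_lt (hnorm.trans_lt hlt))
    rwa [norm_neg, hnorm, hsq, ← sub_eq_add_neg] at h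
end

section
/- Let c, v ∈ S^{d-1} be unit vectors in ℝ^d and let λ > 1. Define ã± := c ± (1/√λ) v and a± := ã±/‖ã±‖₂. Then, in the Loewner order on real symmetric d×d matrices, a⁺(a⁺)ᵀ + a⁻(a⁻)ᵀ ⪰ (2/(1+√λ)²) · v vᵀ. -/
open Matrix

/-- Normalizing a vector of squared length at most `M` scales its inner products by at
least `1 / √M`. -/
theorem sq_dotProduct_div_le_sq_unitize_dotProduct {d : ℕ} {w : Fin d → ℝ} {M : ℝ}
    (hM : ∑ i, w i ^ 2 ≤ M) (x : Fin d → ℝ) :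
    (w ⬝ᵥ x) ^ 2 / M ≤ (unitize w ⬝ᵥ x) ^ 2 := by
  have hN : 0 ≤ ∑ i, w i ^ 2 := Finset.sum_nonneg fun i _ => sq_nonneg (w i)
  rw [unitize, smul_dotProduct, smul_eq_mul, mul_pow, inv_pow, Real.sq_sqrt hN, mul_comm,
    ← div_eq_mul_inv]
  rcases hN.eq_or_lt with h0 | hpos
  · have hw : w = 0 := by
      funext i
      have := (Finset.sum_eq_zero_iff_of_nonneg fun i _ => sq_nonneg (w i)).1 h0.symm i
        (Finset.mem_univ i)
      exact pow_eq_zero_iff two_ne_zero |>.1 this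
    simp [hw]
  · gcongr

/-- The triangle inequality for `c + t v` with `c` and `v` unit vectors, in squared form. -/
theorem sum_sq_add_smul_le {d : ℕ} {c v : Fin d → ℝ}
    (hc : ∑ i, c i ^ 2 = 1) (hv : ∑ i, v i ^ 2 = 1) {t : ℝ} (ht : 0 ≤ t) :
    ∑ i, (c + t • v) i ^ 2 ≤ (1 + t) ^ 2 := by
  calc ∑ i, (c + t • v) i ^ 2 ≤ ∑ i, (1 + t) * (c i ^ 2 + t * v i ^ 2) := by
        refine Finset.sum_le_sum fun i _ => ?_
        simp only [Pi.add_apply, Pi.smul_apply, smul_eq_mul]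
        nlinarith [mul_nonneg ht (sq_nonneg (c i - v i))]
    _ = (1 + t) ^ 2 := by
        rw [← Finset.mul_sum, Finset.sum_add_distrib, ← Finset.mul_sum, hc, hv]
        ring

/-- For unit vectors `c, v ∈ S^{d-1}` and `λ > 1`, with `a±` the normalizations of
`ã± = c ± v/√λ`, one has `a⁺(a⁺)ᵀ + a⁻(a⁻)ᵀ ⪰ (2/(1+√λ)²) v vᵀ` in the Loewner order. -/
theorem rank_one_update_loewner_lower_bound
    {d : ℕ} (c v : Fin d → ℝ)
    (hc : ∑ i, c i ^ 2 = 1) (hv : ∑ i, v i ^ 2 = 1)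
    (lam : ℝ) (hlam : 1 < lam) :
    (vecMulVec (unitize (c + (Real.sqrt lam)⁻¹ • v)) (unitize (c + (Real.sqrt lam)⁻¹ • v))
      + vecMulVec (unitize (c - (Real.sqrt lam)⁻¹ • v)) (unitize (c - (Real.sqrt lam)⁻¹ • v))
      - (2 / (1 + Real.sqrt lam) ^ 2) • vecMulVec v v).PosSemidef := by
  have hs : 0 < Real.sqrt lam := Real.sqrt_pos.2 (by linarith)
  set s := Real.sqrt lam
  have ht : 0 ≤ s⁻¹ := inv_nonneg.2 hs.le
  have hplus : ∑ i, (c + s⁻¹ • v) i ^ 2 ≤ (1 + s⁻¹) ^ 2 := sum_sq_add_smul_le hc hv ht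
  have hminus : ∑ i, (c - s⁻¹ • v) i ^ 2 ≤ (1 + s⁻¹) ^ 2 := by
    simpa [sub_eq_add_neg] using sum_sq_add_smul_le (v := -v) hc (by simpa using hv) ht
  refine PosSemidef.of_dotProduct_mulVec_nonneg ?_ fun x => ?_
  · simp [IsHermitian, conjTranspose_eq_transpose_of_trivial, transpose_vecMulVec]
  · have h₁ := sq_dotProduct_div_le_sq_unitize_dotProduct hplus x
    have h₂ := sq_dotProduct_div_le_sq_unitize_dotProduct hminus x
    have hquad (u : Fin d → ℝ) : x ⬝ᵥ (vecMulVec u u *ᵥ x) = (u ⬝ᵥ x) ^ 2 := by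
      simp [vecMulVec_mulVec, dotProduct_comm x u, sq]
    simp only [star_trivial, sub_mulVec, add_mulVec, smul_mulVec, dotProduct_sub,
      dotProduct_add, dotProduct_smul, hquad, smul_eq_mul]
    rw [add_dotProduct, smul_dotProduct, smul_eq_mul] at h₁
    rw [sub_dotProduct, smul_dotProduct, smul_eq_mul] at h₂
    have hsum : (c ⬝ᵥ x + s⁻¹ * (v ⬝ᵥ x)) ^ 2 / (1 + s⁻¹) ^ 2
        + (c ⬝ᵥ x - s⁻¹ * (v ⬝ᵥ x)) ^ 2 / (1 + s⁻¹) ^ 2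
        = 2 / (1 + s) ^ 2 * (v ⬝ᵥ x) ^ 2 + 2 * (c ⬝ᵥ x / (1 + s⁻¹)) ^ 2 := by
      field_simp
      ring
    linarith [sq_nonneg (c ⬝ᵥ x / (1 + s⁻¹))]
end

section
/- Let λ₀ ≥ 0, C ≥ 0, and let (a_t)_{t≥0} be a sequence of nonnegative real numbers with a₀ ≤ λ₀ and a_t ≤ λ₀ + C Σ_{s=0}^{t−1} √(a_s) for all t ≥ 1. Then for all t ≥ 0, a_t ≤ ( (C/2) t + √λ₀ )², i.e. a_t ≤ (C²/4) t² + C √λ₀ t + λ₀. -/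
/-- Discrete Grönwall-type upper bound: if `a₀ ≤ λ₀` and
`a_t ≤ λ₀ + C Σ_{s<t} √(a_s)` for all `t ≥ 1` with `a_t ≥ 0`, then
`a_t ≤ ((C/2) t + √λ₀)²` for all `t`. -/
theorem discrete_gronwall_upper
    (lam0 C : ℝ) (hlam0 : 0 ≤ lam0) (hC : 0 ≤ C)
    (a : ℕ → ℝ) (ha : ∀ t, 0 ≤ a t) (h0 : a 0 ≤ lam0)
    (hrec : ∀ t : ℕ, 1 ≤ t →
      a t ≤ lam0 + C * ∑ s ∈ Finset.range t, Real.sqrt (a s)) :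
    ∀ t : ℕ, a t ≤ (C / 2 * (t : ℝ) + Real.sqrt lam0) ^ 2 := by
  have le_partial_sum : ∀ t, a t ≤ lam0 + C * ∑ s ∈ Finset.range t, √(a s) := fun t => by
    rcases t.eq_zero_or_pos with rfl | ht
    · simpa using h0
    · exact hrec t ht
  suffices partial_sum_le : ∀ t : ℕ,
      lam0 + C * ∑ s ∈ Finset.range t, √(a s) ≤ (C / 2 * (t : ℝ) + √lam0) ^ 2 from
    fun t => (le_partial_sum t).trans (partial_sum_le t)
  intro t
  induction t with
  | zero => simp [Real.sq_sqrt hlam0]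
  | succ t ih =>
    have sqrt_le : √(a t) ≤ C / 2 * (t : ℝ) + √lam0 :=
      Real.sqrt_le_iff.mpr ⟨by positivity, (le_partial_sum t).trans ih⟩
    rw [Finset.sum_range_succ]
    push_cast
    nlinarith [mul_le_mul_of_nonneg_left sqrt_le hC, sq_nonneg C]
end

section
/- Let γ > 0 and let (a_t)_{t≥1} be a sequence of strictly positive real numbers satisfying a_t ≥ γ Σ_{s=1}^{t} √(a_s) for all t ≥ 1. Then for all t ≥ 1, a_t ≥ γ² t² / 4. -/
/-- A positive solution of `x² ≥ γ (S + x)` with `S ≥ γ n (n + 1) / 4` is at least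
`γ (n + 1) / 2`. -/
lemma le_of_quadratic_lower_bound {γ x S n : ℝ} (hγ : 0 < γ) (hx : 0 < x) (hn : 0 ≤ n)
    (hS : γ * (n * (n + 1)) / 4 ≤ S) (h : γ * (S + x) ≤ x ^ 2) :
    γ * (n + 1) / 2 ≤ x := by
  have hxS : γ * (γ * (n * (n + 1)) / 4) ≤ x * (x - γ) := by
    nlinarith [mul_le_mul_of_nonneg_left hS hγ.le]
  have hγx : γ ≤ x := by
    have h0 : 0 ≤ x * (x - γ) := le_trans (by positivity) hxS
    linarith [nonneg_of_mul_nonneg_right h0 hx]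
  by_contra! hlt
  have hle : x * (x - γ) ≤ γ * (n + 1) / 2 * (γ * (n + 1) / 2 - γ) :=
    mul_le_mul hlt.le (by linarith) (by linarith) (by positivity)
  have hpos : 0 < γ ^ 2 * (n + 1) := by positivity
  nlinarith

/-- If `a_t > 0` and `a_t ≥ γ Σ_{s=1}^{t} √(a_s)` for all `t ≥ 1`, then
`Σ_{s=1}^{n} √(a_s) ≥ γ n (n + 1) / 4`. -/
lemma sum_sqrt_lower_bound {γ : ℝ} (hγ : 0 < γ) {a : ℕ → ℝ}
    (hpos : ∀ t : ℕ, 1 ≤ t → 0 < a t)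
    (hrec : ∀ t : ℕ, 1 ≤ t → γ * ∑ s ∈ Finset.Icc 1 t, Real.sqrt (a s) ≤ a t) (n : ℕ) :
    γ * (n * (n + 1)) / 4 ≤ ∑ s ∈ Finset.Icc 1 n, Real.sqrt (a s) := by
  induction n with
  | zero => simp
  | succ n ih =>
    have ha := hpos (n + 1) (by lia)
    have h := hrec (n + 1) (by lia)
    rw [Finset.sum_Icc_succ_top (by lia)] at h ⊢
    have hx := le_of_quadratic_lower_bound hγ (Real.sqrt_pos.2 ha) n.cast_nonneg ih
      (by rwa [Real.sq_sqrt ha.le])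
    push_cast
    linarith

/-- Discrete Grönwall-type lower bound: if `a_t > 0` and
`a_t ≥ γ Σ_{s=1}^{t} √(a_s)` for all `t ≥ 1`, then `a_t ≥ γ² t² / 4`. -/
theorem discrete_gronwall_lower
    (γ : ℝ) (hγ : 0 < γ) (a : ℕ → ℝ)
    (hpos : ∀ t : ℕ, 1 ≤ t → 0 < a t)
    (hrec : ∀ t : ℕ, 1 ≤ t → γ * ∑ s ∈ Finset.Icc 1 t, Real.sqrt (a s) ≤ a t) :
    ∀ t : ℕ, 1 ≤ t → γ ^ 2 * (t : ℝ) ^ 2 / 4 ≤ a t := by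
  intro t ht
  have h := mul_le_mul_of_nonneg_left (sum_sqrt_lower_bound hγ hpos hrec t) hγ.le
  have ht0 : 0 ≤ γ ^ 2 * (t : ℝ) := by positivity
  nlinarith [hrec t ht]
end

section
/- Let d ≥ 2, β > 0, λ₀ ≥ 1, and define ω(V) := √(λ_max(V)) / (12 √(d−1) β) for real symmetric positive semidefinite d×d matrices V. Let V₀ := λ₀ I and, for each t ≥ 0, let V_{t+1} := V_t + ω(V_t) Σ_{j=1}^{2(d−1)} b_{t,j} b_{t,j}ᵀ, where b_{t,1}, …, b_{t,2(d−1)} ∈ S^{d-1} are arbitrary unit vectors. Then for all t ≥ 0, λ_max(V_t) ≥ t² / ( 4 (1 + 6dβ/√(d−1))² ). -/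
open Matrix
open scoped Classical

/-- The average of the eigenvalues of a real symmetric matrix is at most the largest one. -/
lemma trace_le_mul_matLamMax {n : ℕ} {A : Matrix (Fin n) (Fin n) ℝ} (hA : A.IsHermitian) :
    A.trace ≤ n * matLamMax A := by
  rw [matLamMax, dif_pos hA, hA.trace_eq_sum_eigenvalues]
  calc ∑ i, (hA.eigenvalues i : ℝ) ≤ ∑ _i : Fin n, ⨆ j, hA.eigenvalues j :=
        Finset.sum_le_sum fun i _ => le_ciSup (Set.finite_range hA.eigenvalues).bddAbove i
    _ = n * ⨆ j, hA.eigenvalues j := by simp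

lemma isHermitian_smul_sum_vecMulVec_self {ι κ : Type*} [Fintype κ] (c : ℝ) (b : κ → ι → ℝ) :
    (c • ∑ j, vecMulVec (b j) (b j)).IsHermitian := by
  ext i k
  simp [Matrix.sum_apply, vecMulVec_apply, mul_comm]

lemma trace_smul_sum_vecMulVec_self {ι κ : Type*} [Fintype ι] [Fintype κ] (c : ℝ)
    (b : κ → ι → ℝ) (hb : ∀ j, ∑ i, b j i ^ 2 = 1) :
    (c • ∑ j, vecMulVec (b j) (b j)).trace = c * Fintype.card κ := by
  have h (j : κ) : b j ⬝ᵥ b j = 1 := by simp [dotProduct, ← pow_two, hb]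
  simp [trace_smul, trace_sum, h]

/-- One step of the recursion `u ↦ u + √u / q` raises `√u` by at least `1 / (2 (1 + q))`
once `1 ≤ u`. -/
lemma add_sq_le_sq_add_div {q s : ℝ} (hq : 0 < q) (hs : 1 ≤ s) :
    (s + 1 / (2 * (1 + q))) ^ 2 ≤ s ^ 2 + s / q := by
  have h : s ^ 2 + s / q - (s + 1 / (2 * (1 + q))) ^ 2
      = (4 * s * (1 + q) - q) / (4 * q * (1 + q) ^ 2) := by
    field_simp
    ring
  have : 0 ≤ (4 * s * (1 + q) - q) / (4 * q * (1 + q) ^ 2) :=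
    div_nonneg (by nlinarith) (by positivity)
  linarith

/-- Quadratic growth of the largest eigenvalue of the weighted design matrix:
with `V₀ = λ₀ I`, `λ₀ ≥ 1`, and
`V_{t+1} = V_t + ω(V_t) Σ_{j<2(d-1)} b_{t,j} b_{t,j}ᵀ` for arbitrary unit vectors
`b_{t,j}` and weight `ω(V) = √(λ_max V)/(12 √(d-1) β)`, one has
`λ_max(V_t) ≥ t²/(4(1 + 6dβ/√(d-1))²)` for all `t`. -/
theorem weighted_design_matrix_lamMax_quadratic_growth
    (d : ℕ) (hd : 2 ≤ d) (β : ℝ) (hβ : 0 < β)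
    (lam0 : ℝ) (hlam0 : 1 ≤ lam0)
    (b : ℕ → Fin (2 * (d - 1)) → Fin d → ℝ)
    (hb : ∀ t j, ∑ i, b t j i ^ 2 = 1)
    (V : ℕ → Matrix (Fin d) (Fin d) ℝ)
    (hV0 : V 0 = lam0 • (1 : Matrix (Fin d) (Fin d) ℝ))
    (hVrec : ∀ t, V (t + 1) = V t +
      (Real.sqrt (matLamMax (V t)) / (12 * Real.sqrt ((d : ℝ) - 1) * β)) •
        ∑ j : Fin (2 * (d - 1)), vecMulVec (b t j) (b t j)) :
    ∀ t : ℕ, (t : ℝ) ^ 2 / (4 * (1 + 6 * (d : ℝ) * β / Real.sqrt ((d : ℝ) - 1)) ^ 2)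
      ≤ matLamMax (V t) := by
  have hd2 : (2 : ℝ) ≤ d := by exact_mod_cast hd
  have hr : 0 < Real.sqrt ((d : ℝ) - 1) := Real.sqrt_pos.2 (by linarith)
  have hr2 : Real.sqrt ((d : ℝ) - 1) ^ 2 = (d : ℝ) - 1 := Real.sq_sqrt (by linarith)
  set r := Real.sqrt ((d : ℝ) - 1)
  set q := 6 * (d : ℝ) * β / r with hq_def
  have hq : 0 < q := by positivity
  have hcard : ((2 * (d - 1) : ℕ) : ℝ) = 2 * r ^ 2 := by
    rw [hr2]
    push_cast [Nat.cast_sub (show 1 ≤ d by omega)]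
    ring
  set a := 1 / (2 * (1 + q)) with ha_def
  have ha : 0 < a := by positivity
  have le_lamMax {A : Matrix (Fin d) (Fin d) ℝ} {x : ℝ} (hA : A.IsHermitian)
      (hx : d * x ≤ A.trace) : x ≤ matLamMax A :=
    le_of_mul_le_mul_left (hx.trans (trace_le_mul_matLamMax hA)) (by linarith)
  have key (t : ℕ) : (V t).IsHermitian ∧ d * (1 + a * t) ^ 2 ≤ (V t).trace := by
    induction t with
    | zero =>
      refine ⟨?_, ?_⟩
      · rw [hV0]
        ext i k
        simp [Matrix.one_apply, eq_comm]
      · rw [hV0, trace_smul, trace_one, Fintype.card_fin, smul_eq_mul]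
        push_cast
        nlinarith
    | succ t ih =>
      obtain ⟨hH, hT⟩ := ih
      have hs : 1 + a * t ≤ Real.sqrt (matLamMax (V t)) := Real.le_sqrt_of_sq_le (le_lamMax hH hT)
      have hs1 : 1 ≤ 1 + a * t := le_add_of_nonneg_right (by positivity)
      rw [hVrec]
      refine ⟨hH.add (isHermitian_smul_sum_vecMulVec_self _ _), ?_⟩
      rw [trace_add, trace_smul_sum_vecMulVec_self _ _ (hb t), Fintype.card_fin, hcard]
      have hstep : Real.sqrt (matLamMax (V t)) / (12 * r * β) * (2 * r ^ 2)
          = d * (Real.sqrt (matLamMax (V t)) / q) := by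
        rw [hq_def]
        field_simp
        ring
      rw [hstep]
      calc (d : ℝ) * (1 + a * (t + 1 : ℕ)) ^ 2 = d * (1 + a * t + a) ^ 2 := by push_cast; ring
        _ ≤ d * ((1 + a * t) ^ 2 + (1 + a * t) / q) := by
          gcongr
          exact add_sq_le_sq_add_div hq hs1
        _ = d * (1 + a * t) ^ 2 + d * ((1 + a * t) / q) := by ring
        _ ≤ _ := by gcongr
  intro t
  obtain ⟨hH, hT⟩ := key t
  have hat : 0 ≤ a * t := by positivity
  calc (t : ℝ) ^ 2 / (4 * (1 + q) ^ 2) = (a * t) ^ 2 := by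
        rw [ha_def]
        field_simp
        ring
    _ ≤ (1 + a * t) ^ 2 := by gcongr; linarith
    _ ≤ matLamMax (V t) := le_lamMax hH hT
end

section
/- Let T be a positive integer, let α₁, …, α_T ∈ (0, 1], and let S > 0 satisfy Σ_{t=1}^T α_t ≤ S and S/T ≤ 1/e. Then Σ_{t=1}^T α_t · log(1/α_t) ≤ 2 S · log(T/S). -/
/-- The tangent line at `c` bounds the concave function `a ↦ a log(1/a)` from above. -/
theorem mul_log_one_div_le_tangent {a c : ℝ} (ha : 0 < a) (hc : 0 < c) :
    a * Real.log (1 / a) ≤ c + a * (Real.log (1 / c) - 1) := by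
  have h := mul_le_mul_of_nonneg_left (Real.log_le_sub_one_of_pos (div_pos hc ha)) ha.le
  rw [Real.log_div hc.ne' ha.ne', mul_sub_one, mul_div_cancel₀ _ ha.ne'] at h
  simp only [one_div, Real.log_inv]
  linarith

/-- Entropy-sum bound: if `α₁,…,α_T ∈ (0,1]`, `Σ α_t ≤ S`, `S > 0` and `S/T ≤ 1/e`,
then `Σ α_t log(1/α_t) ≤ 2 S log(T/S)`. -/
theorem sum_entropy_le
    (T : ℕ) (hT : 0 < T) (α : ℕ → ℝ)
    (hα : ∀ t ∈ Finset.Icc 1 T, α t ∈ Set.Ioc (0 : ℝ) 1)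
    (S : ℝ) (hS : 0 < S)
    (hsum : ∑ t ∈ Finset.Icc 1 T, α t ≤ S)
    (hST : S / (T : ℝ) ≤ 1 / Real.exp 1) :
    ∑ t ∈ Finset.Icc 1 T, α t * Real.log (1 / α t) ≤ 2 * S * Real.log ((T : ℝ) / S) := by
  have hT' : (0 : ℝ) < T := Nat.cast_pos.2 hT
  have hc : 0 < S / (T : ℝ) := div_pos hS hT'
  have hL : 1 ≤ Real.log ((T : ℝ) / S) := by
    rw [Real.le_log_iff_exp_le (div_pos hT' hS), ← inv_div, le_inv_comm₀ (Real.exp_pos 1) hc]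
    simpa using hST
  calc ∑ t ∈ Finset.Icc 1 T, α t * Real.log (1 / α t)
      ≤ ∑ t ∈ Finset.Icc 1 T, (S / T + α t * (Real.log ((T : ℝ) / S) - 1)) := by
        refine Finset.sum_le_sum fun t ht => ?_
        simpa only [one_div_div] using mul_log_one_div_le_tangent (hα t ht).1 hc
    _ = S + (∑ t ∈ Finset.Icc 1 T, α t) * (Real.log ((T : ℝ) / S) - 1) := by
        rw [Finset.sum_add_distrib, ← Finset.sum_mul]
        simp [mul_div_cancel₀ S hT'.ne']
    _ ≤ S + S * (Real.log ((T : ℝ) / S) - 1) := by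
        gcongr
    _ ≤ 2 * S * Real.log ((T : ℝ) / S) := by nlinarith
end

section
/- Fix p ∈ (1/2, 1) and set q := 1 − p. For an integer M ≥ 1 let δ_M := (p − 1/2)/M and, for τ ∈ {0, 1, …, M}, let ν_M(τ) := log((p − τ δ_M)/(q + τ δ_M)). Then lim_{M→∞} Σ_{τ=1}^{M−1} (q + τ δ_M) · ( ν_M(τ) − ν_M(τ+1) ) = log(2p). -/
open Filter

/-- The energy gap `ν_M(τ) = log((p - τ δ_M)/(q + τ δ_M))` with `q = 1 - p` and
`δ_M = (p - 1/2)/M`. -/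
noncomputable def nuM (p : ℝ) (M τ : ℕ) : ℝ :=
  Real.log ((p - (τ : ℝ) * ((p - 1 / 2) / (M : ℝ))) /
    ((1 - p) + (τ : ℝ) * ((p - 1 / 2) / (M : ℝ))))

/-- One step of the Riemann sum of `1 / (1 - x)` against its primitive `-log (1 - x)`. -/
lemma log_odds_step_bounds {q x y : ℝ} (hq : 0 < q) (hqx : q ≤ x) (hxy : x ≤ y)
    (hy : y ≤ 1 / 2) :
    (Real.log (1 - x) - Real.log (1 - y)) - 2 / q * (y - x) ^ 2 ≤
        x * (Real.log ((1 - x) / x) - Real.log ((1 - y) / y)) ∧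
      x * (Real.log ((1 - x) / x) - Real.log ((1 - y) / y)) ≤
        Real.log (1 - x) - Real.log (1 - y) := by
  have hx0 : 0 < x := hq.trans_le hqx
  have hy0 : 0 < y := hx0.trans_le hxy
  have hx1 : 0 < 1 - x := by linarith
  have hy1 : 0 < 1 - y := by linarith
  have log_diff_le : ∀ {a b : ℝ}, 0 < a → 0 < b →
      Real.log a - Real.log b ≤ a / b - 1 := fun ha hb => by
    rw [← Real.log_div ha.ne' hb.ne']
    exact Real.log_le_sub_one_of_pos (div_pos ha hb)
  have h1 : x * (Real.log y - Real.log x) ≤ y - x :=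
    (mul_le_mul_of_nonneg_left (log_diff_le hy0 hx0) hx0.le).trans_eq (by field_simp)
  have h2 : x * (Real.log x - Real.log y) ≤ -(y - x) + (y - x) ^ 2 / y :=
    (mul_le_mul_of_nonneg_left (log_diff_le hx0 hy0) hx0.le).trans_eq (by field_simp; ring)
  have h3 : (1 - x) * (Real.log (1 - y) - Real.log (1 - x)) ≤ -(y - x) :=
    (mul_le_mul_of_nonneg_left (log_diff_le hy1 hx1) hx1.le).trans_eq (by field_simp; ring)
  have h4 : (1 - x) * (Real.log (1 - x) - Real.log (1 - y)) ≤
      (y - x) + (y - x) ^ 2 / (1 - y) :=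
    (mul_le_mul_of_nonneg_left (log_diff_le hx1 hy1) hx1.le).trans_eq (by field_simp; ring)
  have h5 : (y - x) ^ 2 / y ≤ (y - x) ^ 2 / q :=
    div_le_div_of_nonneg_left (sq_nonneg _) hq (hqx.trans hxy)
  have h6 : (y - x) ^ 2 / (1 - y) ≤ (y - x) ^ 2 / q :=
    div_le_div_of_nonneg_left (sq_nonneg _) hq (by linarith)
  have h7 : 2 / q * (y - x) ^ 2 = (y - x) ^ 2 / q + (y - x) ^ 2 / q := by ring
  rw [Real.log_div hx1.ne' hx0.ne', Real.log_div hy1.ne' hy0.ne']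
  constructor <;> linarith

/-- Finite-`M` bounds on the expected extracted work. -/
lemma quasistatic_work_bounds {p : ℝ} (hp : p ∈ Set.Ioo (1 / 2 : ℝ) 1) {M : ℕ} (hM : 1 ≤ M) :
    (Real.log (p - (p - 1 / 2) / M) - Real.log (1 / 2)) -
          2 / (1 - p) * (p - 1 / 2) ^ 2 / M ≤
        ∑ τ ∈ Finset.Icc 1 (M - 1),
          ((1 - p) + (τ : ℝ) * ((p - 1 / 2) / (M : ℝ))) * (nuM p M τ - nuM p M (τ + 1)) ∧
      ∑ τ ∈ Finset.Icc 1 (M - 1),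
          ((1 - p) + (τ : ℝ) * ((p - 1 / 2) / (M : ℝ))) * (nuM p M τ - nuM p M (τ + 1)) ≤
        Real.log (p - (p - 1 / 2) / M) - Real.log (1 / 2) := by
  obtain ⟨hp1, hp2⟩ := hp
  have hM0 : (0 : ℝ) < M := by exact_mod_cast hM
  have hIcc : Finset.Icc 1 (M - 1) = Finset.Ico 1 M := by ext; simp; omega
  rw [hIcc]
  set δ : ℝ := (p - 1 / 2) / M with hδ
  have hδ0 : 0 ≤ δ := div_nonneg (by linarith) hM0.le
  have hMδ : M * δ = p - 1 / 2 := by rw [hδ]; field_simp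
  have hstep : ∀ τ ∈ Finset.Ico 1 M,
      (Real.log (p - τ * δ) - Real.log (p - (τ + 1 : ℕ) * δ)) - 2 / (1 - p) * δ ^ 2 ≤
          ((1 - p) + (τ : ℝ) * δ) * (nuM p M τ - nuM p M (τ + 1)) ∧
        ((1 - p) + (τ : ℝ) * δ) * (nuM p M τ - nuM p M (τ + 1)) ≤
          Real.log (p - τ * δ) - Real.log (p - (τ + 1 : ℕ) * δ) := by
    intro τ hτ
    have hle : ((τ + 1 : ℕ) : ℝ) ≤ M := by exact_mod_cast (Finset.mem_Ico.mp hτ).2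
    have hτδ : ((τ + 1 : ℕ) : ℝ) * δ ≤ p - 1 / 2 :=
      (mul_le_mul_of_nonneg_right hle hδ0).trans_eq hMδ
    have h := log_odds_step_bounds (q := 1 - p) (x := (1 - p) + τ * δ)
      (y := (1 - p) + (τ + 1 : ℕ) * δ) (by linarith)
      (by linarith [mul_nonneg τ.cast_nonneg hδ0]) (by push_cast; linarith) (by linarith)
    have e (t : ℝ) : 1 - ((1 - p) + t * δ) = p - t * δ := by ring
    have e' : (1 - p) + (τ + 1 : ℕ) * δ - ((1 - p) + τ * δ) = δ := by push_cast; ring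
    rw [e', e, e] at h
    exact h
  have htel : ∑ τ ∈ Finset.Ico 1 M, (Real.log (p - τ * δ) - Real.log (p - (τ + 1 : ℕ) * δ)) =
      Real.log (p - δ) - Real.log (1 / 2) := by
    have h := Finset.sum_Ico_sub (fun τ : ℕ => -Real.log (p - τ * δ)) hM
    have e : p - M * δ = 1 / 2 := by rw [hMδ]; ring
    simp only [e, Nat.cast_one, one_mul] at h
    rw [← neg_add_eq_sub, add_comm, ← sub_eq_add_neg]
    refine Eq.trans (Finset.sum_congr rfl fun τ _ => ?_) (h.trans ?_) <;> ring
  refine ⟨?_, (Finset.sum_le_sum fun τ hτ => (hstep τ hτ).2).trans_eq htel⟩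
  refine le_trans ?_ (Finset.sum_le_sum fun τ hτ => (hstep τ hτ).1)
  rw [Finset.sum_sub_distrib, htel, Finset.sum_const, Nat.card_Ico, nsmul_eq_mul]
  have hcard : ((M - 1 : ℕ) : ℝ) ≤ M := by exact_mod_cast Nat.sub_le M 1
  have hc : 0 ≤ 2 / (1 - p) * δ ^ 2 :=
    mul_nonneg (div_nonneg zero_le_two (by linarith)) (sq_nonneg _)
  have e : 2 / (1 - p) * (p - 1 / 2) ^ 2 / M = M * (2 / (1 - p) * δ ^ 2) := by
    rw [hδ]; field_simp
  rw [e]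
  exact sub_le_sub_left (mul_le_mul_of_nonneg_right hcard hc) _

/-- Quasi-static limit of the expected extracted work:
`Σ_{τ=1}^{M-1} (q + τ δ_M)(ν_M(τ) - ν_M(τ+1)) → log(2p)` as `M → ∞`. -/
theorem quasistatic_work_limit
    (p : ℝ) (hp : p ∈ Set.Ioo (1 / 2 : ℝ) 1) :
    Tendsto (fun M : ℕ =>
        ∑ τ ∈ Finset.Icc 1 (M - 1),
          ((1 - p) + (τ : ℝ) * ((p - 1 / 2) / (M : ℝ))) * (nuM p M τ - nuM p M (τ + 1)))
      atTop (nhds (Real.log (2 * p))) := by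
  have hp0 : p ≠ 0 := (one_half_pos.trans hp.1).ne'
  have hupper : Tendsto (fun M : ℕ => Real.log (p - (p - 1 / 2) / M) - Real.log (1 / 2))
      atTop (nhds (Real.log (2 * p))) := by
    have h := (tendsto_const_nhds (x := p)).sub (tendsto_const_div_atTop_nhds_zero_nat (p - 1 / 2))
    rw [sub_zero] at h
    convert (h.log hp0).sub_const (Real.log (1 / 2)) using 2
    rw [Real.log_mul two_ne_zero hp0, one_div, Real.log_inv]
    ring
  have hlower := hupper.sub
    (tendsto_const_div_atTop_nhds_zero_nat (2 / (1 - p) * (p - 1 / 2) ^ 2))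
  rw [sub_zero] at hlower
  refine tendsto_of_tendsto_of_tendsto_of_le_of_le' hlower hupper ?_ ?_
  · filter_upwards [eventually_ge_atTop 1] with M hM using (quasistatic_work_bounds hp hM).1
  · filter_upwards [eventually_ge_atTop 1] with M hM using (quasistatic_work_bounds hp hM).2
end

section
/- Fix p ∈ (1/2, 1) and set q := 1 − p. For an integer M ≥ 1 let δ_M := (p − 1/2)/M and, for τ ∈ {0, 1, …, M}, let ν_M(τ) := log((p − τ δ_M)/(q + τ δ_M)). Then for every τ ∈ {0, 1, …, M−1}, 0 ≤ ν_M(τ) − ν_M(τ+1) ≤ 2 δ_M / q. -/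
/-- A linear upper bound for increments of `log` on `[c, ∞)`. -/
theorem log_sub_log_le_div {c x y : ℝ} (hc : 0 < c) (hcy : c ≤ y) (hyx : y ≤ x) :
    Real.log x - Real.log y ≤ (x - y) / c := by
  have hy : 0 < y := hc.trans_le hcy
  have hx : 0 < x := hy.trans_le hyx
  calc Real.log x - Real.log y = Real.log (x / y) := (Real.log_div hx.ne' hy.ne').symm
    _ ≤ x / y - 1 := Real.log_le_sub_one_of_pos (div_pos hx hy)
    _ = (x - y) / y := by field_simp
    _ ≤ (x - y) / c := div_le_div_of_nonneg_left (sub_nonneg.2 hyx) hc hcy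

/-- For `p ∈ (1/2, 1)`, `M ≥ 1` and `τ ∈ {0,…,M-1}`, the gap increment satisfies
`0 ≤ ν_M(τ) - ν_M(τ+1) ≤ 2 δ_M / q` where `q = 1-p` and `δ_M = (p-1/2)/M`. -/
theorem nu_gap_increment_bounds
    (p : ℝ) (hp : p ∈ Set.Ioo (1 / 2 : ℝ) 1)
    (M : ℕ) (hM : 1 ≤ M) (τ : ℕ) (hτ : τ < M) :
    0 ≤ nuM p M τ - nuM p M (τ + 1) ∧
      nuM p M τ - nuM p M (τ + 1) ≤ 2 * ((p - 1 / 2) / (M : ℝ)) / (1 - p) := by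
  obtain ⟨hp₁, hp₂⟩ := hp
  have hM₀ : (0 : ℝ) < M := by exact_mod_cast hM
  unfold nuM
  push_cast
  set δ := (p - 1 / 2) / (M : ℝ)
  have hδ₀ : 0 ≤ δ := div_nonneg (by linarith) hM₀.le
  have hMδ : (M : ℝ) * δ = p - 1 / 2 := mul_div_cancel₀ _ hM₀.ne'
  have hτδ : ((τ : ℝ) + 1) * δ ≤ p - 1 / 2 := by
    rw [← hMδ]
    exact mul_le_mul_of_nonneg_right (by exact_mod_cast hτ) hδ₀
  have hτ₀ : 0 ≤ (τ : ℝ) * δ := by positivity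
  have hsucc : ((τ : ℝ) + 1) * δ = τ * δ + δ := by ring
  rw [hsucc] at hτδ ⊢
  have hq : 0 < 1 - p := by linarith
  have ha : 0 < p - (τ * δ + δ) := by linarith
  have hb : 0 < 1 - p + τ * δ := by linarith
  rw [Real.log_div (by linarith) hb.ne', Real.log_div ha.ne' (by linarith)]
  have hnum_mono : Real.log (p - (τ * δ + δ)) ≤ Real.log (p - τ * δ) :=
    Real.log_le_log ha (by linarith)
  have hden_mono : Real.log (1 - p + τ * δ) ≤ Real.log (1 - p + (τ * δ + δ)) :=
    Real.log_le_log hb (by linarith)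
  have hnum : Real.log (p - τ * δ) - Real.log (p - (τ * δ + δ)) ≤ δ / (1 - p) :=
    (log_sub_log_le_div hq (by linarith) (by linarith)).trans_eq (by ring)
  have hden : Real.log (1 - p + (τ * δ + δ)) - Real.log (1 - p + τ * δ) ≤ δ / (1 - p) :=
    (log_sub_log_le_div hq (by linarith) (by linarith)).trans_eq (by ring)
  have hsum : 2 * δ / (1 - p) = δ / (1 - p) + δ / (1 - p) := by ring
  constructor <;> linarith
end
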